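/- arXiv:0712.3213 — 7 statements merged into one kernel-verified Lean document; each statement's English description precedes it below -/
import Mathlib

section
/- Let m be a positive integer and let a = (a_0, …, a_{m−1}) be nonnegative integers with a_0 + ⋯ + a_{m−1} = n. Let k, l be integers with 0 ≤ k ≤ n and 0 ≤ l ≤ m, and suppose that for every j with 0 ≤ j < m one has a_j + a_{j+1} + ⋯ + a_{j+l−1} ≤ k + 1 (indices read modulo m; this says the point (k+1, l) lies weakly to the right of every cyclically shifted boundary ∂σ^j(a)). Then the number of pairs (P, j) with 0 ≤ j < m and P a lattice path from (0,0) with terminus (k,l) that is NOT dominated by σ^j(a) equals n·binomial(k+l, l−1). -/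
/-- A lattice path is a list of steps: `false` = R-step `(1,0)`, `true` = U-step `(0,1)`,
starting at the origin.  `Dominated b P` says that for every `d` with
`0 ≤ d <` (number of U-steps of `P`), the number of R-steps of `P` preceding its
`(d+1)`-st U-step is at least `b 0 + b 1 + ⋯ + b d`. -/
def Dominated (b : ℕ → ℕ) (P : List Bool) : Prop :=
  ∀ q r : List Bool, P = q ++ true :: r →
    ∑ i ∈ Finset.range (q.count true + 1), b i ≤ q.count false

/-- The `j`-th cyclic shift `σ^j(a)` of an `m`-tuple `a`, as a function on indices read
modulo `m`: its `i`-th entry is `a ((i - j) mod m)`, here written `a ((i + (m - j)) % m)`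
(valid for `0 ≤ j ≤ m`). -/
def shiftComp (m j : ℕ) (a : ℕ → ℕ) : ℕ → ℕ :=
  fun i => a ((i + (m - j)) % m)

/-- `binomial N r` for an integer lower index `r` (zero when `r < 0`). -/
def chooseInt (N : ℕ) (r : ℤ) : ℕ :=
  if 0 ≤ r then N.choose r.toNat else 0

/-- `q` is a position at which `B` first holds, among the positions followed by the step `s`
in any list starting with `q ++ [s]`. -/
def IsFirst (s : Bool) (B : List Bool → Prop) (q : List Bool) : Prop :=
  B q ∧ ∀ q' r', q = q' ++ s :: r' → ¬ B q'

theorem exists_isFirst (s : Bool) (B : List Bool → Prop) (L : List Bool)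
    (h : ∃ q r, L = q ++ s :: r ∧ B q) : ∃ q r, L = q ++ s :: r ∧ IsFirst s B q := by
  classical
  obtain ⟨q, r, hL, hq⟩ := h
  induction hn : q.length using Nat.strong_induction_on generalizing q r with
  | _ n ih =>
    by_cases hf : ∀ q' r', q = q' ++ s :: r' → ¬ B q'
    · exact ⟨q, r, hL, hq, hf⟩
    · push Not at hf
      obtain ⟨q', r', rfl, hq'⟩ := hf
      exact ih q'.length (by simp at hn; omega) q' (r' ++ s :: r) (by simp [hL]) hq' rfl

theorem IsFirst.unique {s : Bool} {B : List Bool → Prop} {q r q' r' : List Bool}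
    (hq : IsFirst s B q) (hq' : IsFirst s B q') (h : q ++ s :: r = q' ++ s :: r') :
    q = q' ∧ r = r' := by
  rcases List.append_eq_append_iff.1 h with ⟨c, hc, hr⟩ | ⟨c, hc, hr⟩
  · cases c with
    | nil => simp_all
    | cons x c =>
      obtain ⟨rfl, -⟩ : s = x ∧ r = c ++ s :: r' := by simpa using hr
      exact absurd hq.1 (hq'.2 _ _ hc)
  · cases c with
    | nil => simp_all
    | cons x c =>
      obtain ⟨rfl, -⟩ : s = x ∧ r' = c ++ s :: r := by simpa using hr
      exact absurd hq'.1 (hq.2 _ _ hc)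

/-- The step following `q`, if it is a U-step, leaves the region below the boundary with row
lengths `b`. -/
def Crosses (b : ℕ → ℕ) (q : List Bool) : Prop :=
  q.count false < ∑ x ∈ Finset.range (q.count true + 1), b x

/-- The step following `w`, if it is an R-step, leaves the region above the boundary with row
lengths `b`, translated to the left by `t + 1`. -/
def CrossesBack (b : ℕ → ℕ) (t : ℕ) (w : List Bool) : Prop :=
  ∑ v ∈ Finset.range (w.count true + 1), b v ≤ w.count false + t + 1

theorem sum_le_count_of_not_crosses {b : ℕ → ℕ} (q : List Bool)
    (h : ∀ q' r', q = q' ++ true :: r' → ¬ Crosses b q') :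
    ∑ x ∈ Finset.range (q.count true), b x ≤ q.count false := by
  induction q using List.reverseRecOn with
  | nil => simp
  | append_singleton p s ih =>
    cases s with
    | false =>
      have := ih fun q' r' hp => h q' (r' ++ [false]) (by simp [hp])
      simpa using this.trans (Nat.le_succ _)
    | true => simpa [Crosses] using h p [] rfl

theorem count_lt_sum_of_not_crossesBack {b : ℕ → ℕ} {t : ℕ} (ht : t < b 0) (w : List Bool)
    (h : ∀ w' r', w = w' ++ false :: r' → ¬ CrossesBack b t w') :
    w.count false + t < ∑ v ∈ Finset.range (w.count true + 1), b v := by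
  induction w using List.reverseRecOn with
  | nil => simpa using ht
  | append_singleton p s ih =>
    cases s with
    | false =>
      have := h p [] rfl
      simp only [CrossesBack, not_le] at this
      simp
      omega
    | true =>
      have := ih fun w' r' hp => h w' (r' ++ [true]) (by simp [hp])
      have e : (p ++ [true]).count true + 1 = p.count true + 1 + 1 := by simp
      rw [e, Finset.sum_range_succ]
      simp
      omega

section Reversal

variable {b c : ℕ → ℕ} {d : ℕ}

theorem sum_add_sum_of_reverse (hbc : ∀ x v, x + v = d → b x = c v) :
    ∀ u e, u + e = d + 1 → ∑ v ∈ Finset.range u, c v + ∑ x ∈ Finset.range e, b x =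
      ∑ x ∈ Finset.range (d + 1), b x := by
  intro u
  induction u with
  | zero => rintro e he; simp [← he]
  | succ u ih =>
    intro e he
    rw [← ih (e + 1) (by omega), Finset.sum_range_succ, Finset.sum_range_succ,
      hbc e u (by omega)]
    ring

theorem IsFirst.crossesBack_reverse {q : List Bool} (hd : q.count true = d)
    (hbc : ∀ x v, x + v = d → b x = c v) (hq : IsFirst true (Crosses b) q) {t : ℕ}
    (ht : q.count false + t + 1 = ∑ x ∈ Finset.range (d + 1), b x) :
    t < c 0 ∧ IsFirst false (CrossesBack c t) q.reverse := by
  have hs := sum_add_sum_of_reverse hbc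
  have hle := sum_le_count_of_not_crosses q hq.2
  refine ⟨?_, ?_, ?_⟩
  · have := hs 1 d (by omega)
    simp at this
    rw [hd] at hle
    omega
  · have := hs (d + 1) 0 (by omega)
    simp at this
    simp [CrossesBack, hd]
    omega
  · intro w' r' hw
    have hq' : q = r'.reverse ++ false :: w'.reverse := by
      rw [← List.reverse_reverse q, hw]; simp
    have h1 := sum_le_count_of_not_crosses r'.reverse fun q'' r'' h =>
      hq.2 q'' (r'' ++ false :: w'.reverse) (by rw [hq', h]; simp)
    have hct : q.count true = r'.count true + w'.count true := by simp [hq']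
    have hcf : q.count false = r'.count false + w'.count false + 1 := by simp [hq']; ring
    have := hs (w'.count true + 1) (r'.count true) (by omega)
    simp only [List.count_reverse] at h1
    simp only [CrossesBack]
    omega

theorem IsFirst.crosses_reverse {w : List Bool} (hd : w.count true = d)
    (hbc : ∀ x v, x + v = d → b x = c v) {t : ℕ} (ht : t < c 0)
    (hw : IsFirst false (CrossesBack c t) w) :
    w.count false + t + 1 = ∑ x ∈ Finset.range (d + 1), b x ∧
      IsFirst true (Crosses b) w.reverse := by
  have hs := sum_add_sum_of_reverse hbc
  have hlt := count_lt_sum_of_not_crossesBack ht w hw.2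
  have hle := hw.1
  have h0 := hs (d + 1) 0 (by omega)
  simp only [CrossesBack] at hle
  simp only [Finset.range_zero, Finset.sum_empty] at h0
  rw [hd] at hlt hle
  refine ⟨by omega, ?_, ?_⟩
  · simp only [Crosses, List.count_reverse, hd]
    omega
  · intro q' r' hq
    have hw' : w = r'.reverse ++ true :: q'.reverse := by
      rw [← List.reverse_reverse w, hq]; simp
    have h1 := count_lt_sum_of_not_crossesBack ht r'.reverse fun w'' r'' h =>
      hw.2 w'' (r'' ++ true :: q'.reverse) (by rw [hw', h]; simp)
    have hct : w.count true = r'.count true + q'.count true + 1 := by simp [hw']; ring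
    have hcf : w.count false = r'.count false + q'.count false := by simp [hw']
    have := hs (r'.count true + 1) (q'.count true + 1) (by omega)
    simp only [List.count_reverse] at h1
    simp only [Crosses]
    omega

end Reversal

theorem card_paths (k l : ℕ) :
    Nat.card {Q : List Bool // Q.count false = k ∧ Q.count true = l} = (k + l).choose l := by
  suffices h : ∃ s : Finset (List Bool), (∀ Q, Q ∈ s ↔ Q.count false = k ∧ Q.count true = l) ∧
      s.card = (k + l).choose l by
    obtain ⟨s, hs, hc⟩ := h
    rw [← hc, ← Nat.card_eq_finsetCard]
    exact Nat.card_congr (Equiv.subtypeEquivRight fun Q => (hs Q).symm)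
  have key : ∀ n k l, k + l = n → ∃ s : Finset (List Bool),
      (∀ Q, Q ∈ s ↔ Q.count false = k ∧ Q.count true = l) ∧ s.card = (k + l).choose l := by
    intro n
    induction n with
    | zero =>
      intro k l h
      obtain ⟨rfl, rfl⟩ : k = 0 ∧ l = 0 := by omega
      refine ⟨{[]}, fun Q => ?_, by simp⟩
      rcases Q with _ | ⟨_ | _, Q⟩ <;> simp
    | succ n ih =>
      intro k l h
      have hF : ∃ s : Finset (List Bool),
          (∀ Q, Q ∈ s ↔ Q.count false + 1 = k ∧ Q.count true = l) ∧
          s.card = if k = 0 then 0 else n.choose l := by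
        rcases k with _ | k
        · exact ⟨∅, by simp, by simp⟩
        · obtain ⟨s, hs, hc⟩ := ih k l (by omega)
          exact ⟨s, by simpa using hs, by simp [hc, show k + l = n by omega]⟩
      have hT : ∃ s : Finset (List Bool),
          (∀ Q, Q ∈ s ↔ Q.count false = k ∧ Q.count true + 1 = l) ∧
          s.card = if l = 0 then 0 else n.choose (l - 1) := by
        rcases l with _ | l
        · exact ⟨∅, by simp, by simp⟩
        · obtain ⟨s, hs, hc⟩ := ih k l (by omega)
          exact ⟨s, by simpa using hs, by simp [hc, show k + l = n by omega]⟩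
      obtain ⟨s, hs, hsc⟩ := hF
      obtain ⟨s', hs', hsc'⟩ := hT
      refine ⟨s.map ⟨List.cons false, List.cons_injective⟩ ∪
        s'.map ⟨List.cons true, List.cons_injective⟩, fun Q => ?_, ?_⟩
      · rcases Q with _ | ⟨_ | _, Q⟩
        · simp; omega
        · simp [hs]
        · simp [hs']
      · rw [Finset.card_union_of_disjoint, Finset.card_map, Finset.card_map, hsc, hsc', h]
        · rcases l with _ | l
          · simp [show k ≠ 0 by omega]
          · rcases k with _ | k
            · obtain rfl : l = n := by omega
              simp
            · simp [Nat.choose_succ_succ, add_comm]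
        · simp [Finset.disjoint_left]
  exact key _ k l rfl

/-- First crossings of paths with `k` R-steps and `l + 1` U-steps through the boundaries
`x ↦ α (x - j)`: a crossing U-step separates the path into the two given lists. -/
abbrev Crossing {m : ℕ} (α : ZMod m → ℕ) (k l : ℕ) : Type :=
  {c : List Bool × List Bool × ZMod m //
    IsFirst true (Crosses fun x => α (x - c.2.2)) c.1 ∧
    c.1.count false + c.2.1.count false = k ∧ c.1.count true + c.2.1.count true = l}

theorem card_crossing_eq_mul {m : ℕ} [NeZero m] (α : ZMod m → ℕ) (k l : ℕ)
    (h : ∀ i, ∑ v ∈ Finset.range (l + 1), α (i - v) ≤ k + 1) :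
    Nat.card (Crossing α k l) = (∑ i, α i) * (k + 1 + l).choose l := by
  let B := {Q : List Bool // Q.count false = k + 1 ∧ Q.count true = l} × Σ i, Fin (α i)
  have hB : Nat.card B = (∑ i, α i) * (k + 1 + l).choose l := by
    rw [Nat.card_prod, card_paths, Nat.card_sigma, mul_comm]
    simp
  rw [← hB]
  have hrev : ∀ (j : ZMod m) (d x v : ℕ), x + v = d →
      α ((x : ZMod m) - j) = α ((d : ZMod m) - j - v) := by
    rintro j d x v rfl
    congr 1
    push_cast
    ring
  have hfwd : ∀ c : Crossing α k l, ∃ t,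
      t < α (c.1.1.count true - c.1.2.2) ∧
      IsFirst false (CrossesBack (fun v => α (c.1.1.count true - c.1.2.2 - v)) t)
        c.1.1.reverse := by
    rintro ⟨⟨q, r, j⟩, hq, h1, h2⟩
    obtain ⟨t, ht⟩ := Nat.exists_eq_add_of_lt hq.1
    have := hq.crossesBack_reverse rfl (hrev j _) ht.symm
    exact ⟨t, by simpa using this.1, this.2⟩
  choose t ht hfirst using hfwd
  let f : Crossing α k l → B := fun c =>
    (⟨c.1.1.reverse ++ false :: c.1.2.1, by
        have := c.2.2.1
        have := c.2.2.2
        constructor <;> simp <;> omega⟩,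
      ⟨c.1.1.count true - c.1.2.2, t c, ht c⟩)
  refine Nat.card_eq_of_bijective f ⟨?_, ?_⟩
  · intro c c' hc
    have hQ := congrArg (fun x : B => x.1.1) hc
    have hi := congrArg (fun x : B => x.2.1) hc
    have ht' := congrArg (fun x : B => (x.2.2 : ℕ)) hc
    simp only [f] at hQ hi ht'
    have hf' := hfirst c'
    rw [← hi, ← ht'] at hf'
    obtain ⟨e1, e2⟩ := (hfirst c).unique hf' hQ
    have e1 := List.reverse_injective e1
    rw [e1] at hi
    exact Subtype.ext (Prod.ext e1 (Prod.ext e2 (sub_right_injective hi)))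
  · rintro ⟨⟨Q, hk, hl⟩, i, s, hs⟩
    have hex : ∃ w r, Q = w ++ false :: r ∧ CrossesBack (fun v => α (i - v)) s w := by
      by_contra! hno
      have := count_lt_sum_of_not_crossesBack (by simpa using hs) Q hno
      have := h i
      rw [hk, hl] at *
      omega
    obtain ⟨w, r, rfl, hw⟩ := exists_isFirst _ _ _ hex
    obtain ⟨hsum, hw'⟩ := hw.crosses_reverse (b := fun x => α (x - (w.count true - i))) rfl
      (by rintro x v hx; rw [← hx]; push_cast; congr 1; ring) (by simpa using hs)
    let c : Crossing α k l := ⟨(w.reverse, r, w.count true - i), hw', by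
      simp at hk hl ⊢
      omega⟩
    have hci : (c.1.1.count true : ZMod m) - c.1.2.2 = i := by simp [c]
    have htc := (hfirst c).crosses_reverse (b := fun x => α (x - c.1.2.2)) rfl
      (by simpa using hrev c.1.2.2 _) (by simpa using ht c)
    have hts : t c = s := by
      have := htc.1
      simp [c] at this hsum ⊢
      omega
    refine ⟨c, Prod.ext (Subtype.ext (by simp [f, c])) ?_⟩
    simp only [f]
    refine Sigma.ext hci ?_
    exact (Fin.heq_ext_iff (congrArg α hci)).2 hts

theorem not_dominated_iff {b : ℕ → ℕ} {P : List Bool} :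
    ¬ Dominated b P ↔ ∃ q r, P = q ++ true :: r ∧ Crosses b q := by
  simp [Dominated, Crosses]

theorem shiftComp_val {m : ℕ} [NeZero m] (a : ℕ → ℕ) (j : ZMod m) :
    shiftComp m j.val a = fun x : ℕ => a ((x : ZMod m) - j).val := by
  funext x
  rw [shiftComp, ← ZMod.val_natCast]
  congr 2
  push_cast [Nat.cast_sub j.val_lt.le]
  simp [sub_eq_add_neg]

theorem card_not_dominated_eq_card_crossing {m : ℕ} [NeZero m] (a : ℕ → ℕ) (k l : ℕ) :
    Nat.card {Pj : List Bool × ℕ //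
        Pj.2 < m ∧ Pj.1.count false = k ∧ Pj.1.count true = l + 1 ∧
        ¬ Dominated (shiftComp m Pj.2 a) Pj.1} =
      Nat.card (Crossing (fun i : ZMod m => a i.val) k l) := by
  symm
  refine Nat.card_eq_of_bijective (fun c => ⟨(c.1.1 ++ true :: c.1.2.1, c.1.2.2.val),
    c.1.2.2.val_lt, by simpa using c.2.2.1, by simpa [← add_assoc] using c.2.2.2,
    not_dominated_iff.2 ⟨_, _, rfl, by rw [shiftComp_val]; exact c.2.1.1⟩⟩) ⟨?_, ?_⟩
  · rintro ⟨⟨q, r, j⟩, hq, h⟩ ⟨⟨q', r', j'⟩, hq', h'⟩ hc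
    simp only [Subtype.mk.injEq, Prod.mk.injEq] at hc
    obtain rfl := ZMod.val_injective m hc.2
    obtain ⟨rfl, rfl⟩ := hq.unique hq' hc.1
    rfl
  · rintro ⟨⟨P, j⟩, hj, hk, hl, hP⟩
    obtain ⟨q, r, rfl, hq⟩ := exists_isFirst _ _ _ (not_dominated_iff.1 hP)
    have hv : (j : ZMod m).val = j := ZMod.val_natCast_of_lt hj
    refine ⟨⟨(q, r, (j : ZMod m)), ?_, ?_⟩, ?_⟩
    · simpa only [← shiftComp_val, hv] using hq
    · simp at hk hl ⊢
      omega
    · simp [hv]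

theorem stmt0 (m n k l : ℕ) (hm : 0 < m) (a : ℕ → ℕ)
    (hsum : ∑ i ∈ Finset.range m, a i = n)
    (hk : k ≤ n) (hl : l ≤ m)
    (hbd : ∀ j < m, ∑ i ∈ Finset.range l, a ((j + i) % m) ≤ k + 1) :
    Nat.card {Pj : List Bool × ℕ //
        Pj.2 < m ∧ Pj.1.count false = k ∧ Pj.1.count true = l ∧
        ¬ Dominated (shiftComp m Pj.2 a) Pj.1} =
      n * chooseInt (k + l) ((l : ℤ) - 1) := by
  have : NeZero m := ⟨hm.ne'⟩
  rcases l with _ | l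
  · have : IsEmpty {Pj : List Bool × ℕ //
        Pj.2 < m ∧ Pj.1.count false = k ∧ Pj.1.count true = 0 ∧
        ¬ Dominated (shiftComp m Pj.2 a) Pj.1} := by
      refine ⟨fun ⟨⟨P, j⟩, _, _, hl, hP⟩ => ?_⟩
      obtain ⟨q, r, rfl, -⟩ := not_dominated_iff.1 hP
      simp at hl
    simp [chooseInt]
  · rw [card_not_dominated_eq_card_crossing, card_crossing_eq_mul]
    · have hn : ∑ i : ZMod m, a i.val = n := by
        rw [← hsum]
        refine Finset.sum_nbij ZMod.val (fun i _ => Finset.mem_range.2 i.val_lt)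
          (ZMod.val_injective m).injOn (fun x hx => ?_) fun _ _ => rfl
        exact ⟨x, by simp, ZMod.val_natCast_of_lt (by simpa using hx)⟩
      have hc : k + 1 + l = k + (l + 1) := by ring
      simp [hn, hc, chooseInt]
    · intro i
      refine le_trans (le_of_eq ?_) (hbd (i - l).val (ZMod.val_lt _))
      rw [← Finset.sum_range_reflect]
      refine Finset.sum_congr rfl fun x hx => ?_
      rw [← ZMod.val_natCast]
      congr 2
      have hx : x ≤ l := by simpa [Nat.lt_succ_iff] using hx
      rw [show l + 1 - 1 - x = l - x by omega]
      push_cast [Nat.cast_sub hx]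
      simp
      ring
end

section
/- Let m be a positive integer and let a = (a_0, …, a_{m−1}) be nonnegative integers with a_0 + ⋯ + a_{m−1} = n. Let k, l be integers with 0 ≤ k ≤ n and 0 ≤ l ≤ m, and suppose that for every j with 0 ≤ j < m one has a_j + a_{j+1} + ⋯ + a_{j+l−1} ≤ k + 1 (indices read modulo m). Then Σ_{j=0}^{m−1} D(σ^j(a), (k,l)) = m·binomial(k+l, l) − n·binomial(k+l, l−1); equivalently, (k+1)·Σ_{j=0}^{m−1} D(σ^j(a), (k,l)) = (m(k+1) − n·l)·binomial(k+l, l). -/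
/-- `D b (k,l)`: the number of lattice paths from `(0,0)` with terminus `(k,l)`
(that is, `k` R-steps and `l` U-steps) dominated by `b`. -/
noncomputable def D (b : ℕ → ℕ) (k l : ℕ) : ℕ :=
  Nat.card {P : List Bool // P.count false = k ∧ P.count true = l ∧ Dominated b P}

/-- The words with `k` letters `false` and `l` letters `true`. -/
def words : ℕ → ℕ → Finset (List Bool)
  | 0, 0 => {[]}
  | k + 1, 0 => (words k 0).image (List.cons false)
  | 0, l + 1 => (words 0 l).image (List.cons true)
  | k + 1, l + 1 =>
      (words k (l + 1)).image (List.cons false) ∪ (words (k + 1) l).image (List.cons true)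

theorem mem_words (P : List Bool) (k l : ℕ) :
    P ∈ words k l ↔ P.count false = k ∧ P.count true = l := by
  induction P generalizing k l with
  | nil => cases k <;> cases l <;> simp [words]
  | cons u P ih => cases k <;> cases l <;> cases u <;> simp [words, ih]

theorem card_words (k l : ℕ) : (words k l).card = (k + l).choose l := by
  induction k, l using words.induct with
  | case1 => simp [words]
  | case2 k ih =>
    rw [words, Finset.card_image_of_injective _ List.cons_injective, ih]
    simp
  | case3 l ih =>
    rw [words, Finset.card_image_of_injective _ List.cons_injective, ih]
    simp
  | case4 k l ih₁ ih₂ =>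
    rw [words, Finset.card_union_of_disjoint,
      Finset.card_image_of_injective _ List.cons_injective,
      Finset.card_image_of_injective _ List.cons_injective, ih₁, ih₂,
      show k + 1 + (l + 1) = (k + 1 + l) + 1 by ring, Nat.choose_succ_succ,
      show k + (l + 1) = k + 1 + l by ring, add_comm]
    simp [Finset.disjoint_left]

/-- A word with a prefix satisfying `p` splits at the first such prefix. -/
theorem exists_first_passage {α : Type*} (p : List α → Prop) (hnil : ¬ p [])
    {W : List α} (h : ∃ q, q <+: W ∧ p q) :
    ∃ V u F, W = V ++ u :: F ∧ (∀ q, q <+: V → ¬ p q) ∧ p (V ++ [u]) := by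
  classical
  induction W using List.reverseRecOn with
  | nil =>
    obtain ⟨q, hq, hp⟩ := h
    rw [List.prefix_nil] at hq
    exact absurd (hq ▸ hp) hnil
  | append_singleton W u ih =>
    by_cases hW : ∃ q, q <+: W ∧ p q
    · obtain ⟨V, v, F, rfl, hV⟩ := ih hW
      exact ⟨V, v, F ++ [u], by simp, hV⟩
    · push Not at hW
      obtain ⟨q, hq, hp⟩ := h
      refine ⟨W, u, [], rfl, hW, ?_⟩
      rcases List.prefix_concat_iff.mp hq with rfl | hq
      · exact hp
      · exact absurd hp (hW q hq)

theorem first_passage_unique {α : Type*} (p : List α → Prop) {V V' F F' : List α} {u : α}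
    (h : V ++ u :: F = V' ++ u :: F')
    (hV : ∀ q, q <+: V → ¬ p q) (hVu : p (V ++ [u]))
    (hV' : ∀ q, q <+: V' → ¬ p q) (hVu' : p (V' ++ [u])) : V = V' ∧ F = F' := by
  rcases List.append_eq_append_iff.mp h with ⟨s, rfl, hs⟩ | ⟨s, rfl, hs⟩
  · rcases s with _ | ⟨w, s⟩
    · simpa using hs
    · obtain ⟨rfl, rfl⟩ := List.cons.inj hs
      exact absurd hVu (hV' _ ⟨s, by simp⟩)
  · rcases s with _ | ⟨w, s⟩
    · simpa using hs.symm
    · obtain ⟨rfl, rfl⟩ := List.cons.inj hs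
      exact absurd hVu' (hV _ ⟨s, by simp⟩)

theorem dominated_iff_prefix (b : ℕ → ℕ) (P : List Bool) :
    Dominated b P ↔
      ∀ q, q <+: P → ∑ i ∈ Finset.range (q.count true), b i ≤ q.count false := by
  constructor
  · intro h q
    induction q using List.reverseRecOn with
    | nil => simp
    | append_singleton q u ih =>
      intro hq
      have := ih ((List.prefix_append q [u]).trans hq)
      obtain ⟨r, hr⟩ := hq
      cases u with
      | false => simpa using this.trans (Nat.le_succ _)
      | true => simpa using h q r (by simpa using hr.symm)
  · rintro h q r rfl
    simpa using h (q ++ [true]) ⟨r, by simp⟩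

theorem D_eq_card_filter (b : ℕ → ℕ) (k l : ℕ) [DecidablePred (Dominated b)] :
    D b k l = ((words k l).filter (Dominated b)).card := by
  rw [D, ← Nat.card_eq_finsetCard]
  exact Nat.card_congr (Equiv.subtypeEquivRight fun P => by simp [mem_words, and_assoc])

/-- The horizontal extent of the `d` rows, starting at row `c`, of the periodic boundary `A`. -/
def rowSum {m : ℕ} (A : ZMod m → ℕ) (c : ZMod m) (d : ℕ) : ℕ :=
  ∑ i ∈ Finset.range d, A (c + i)

theorem rowSum_zero {m : ℕ} (A : ZMod m → ℕ) (c : ZMod m) : rowSum A c 0 = 0 := by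
  simp [rowSum]

theorem rowSum_succ {m : ℕ} (A : ZMod m → ℕ) (c : ZMod m) (d : ℕ) :
    rowSum A c (d + 1) = rowSum A c d + A (c + d) := Finset.sum_range_succ _ _

theorem rowSum_add {m : ℕ} (A : ZMod m → ℕ) (c : ZMod m) (d e : ℕ) :
    rowSum A c (d + e) = rowSum A c d + rowSum A (c + d) e := by
  simp [rowSum, Finset.sum_range_add, add_assoc]

/-- Triples `(c, Q, F)` such that the path `Q U F`, started at row `c`, crosses the boundary `A`
for the first time at its displayed `U`-step. -/
def crossings {m : ℕ} (A : ZMod m → ℕ) (k l : ℕ) : Set (ZMod m × List Bool × List Bool) :=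
  {x | (∀ q, q <+: x.2.1 → ¬ q.count false < rowSum A x.1 (q.count true)) ∧
    (x.2.1 ++ [true]).count false < rowSum A x.1 ((x.2.1 ++ [true]).count true) ∧
    x.2.1.count false + x.2.2.count false = k ∧ x.2.1.count true + x.2.2.count true = l}

theorem ncard_crossings_eq_sum {m : ℕ} [NeZero m] (A : ZMod m → ℕ) (k l : ℕ)
    [∀ c : ZMod m, DecidablePred (Dominated fun i => A (c + i))] :
    (crossings A k l).ncard =
      ∑ c, ((words k (l + 1)).filter fun P => ¬ Dominated (fun i => A (c + i)) P).card := by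
  rw [← Finset.card_sigma, ← Set.ncard_coe_finset]
  have hinj : Set.InjOn (fun x : ZMod m × List Bool × List Bool =>
      (⟨x.1, x.2.1 ++ true :: x.2.2⟩ : Σ _ : ZMod m, List Bool)) (crossings A k l) := by
    rintro ⟨c, Q, F⟩ ⟨hQ, hQt, -⟩ ⟨c', Q', F'⟩ ⟨hQ', hQt', -⟩ h
    simp only [Sigma.mk.injEq, heq_eq_eq] at h
    obtain ⟨rfl, h⟩ := h
    obtain ⟨rfl, rfl⟩ := first_passage_unique
      (fun q => q.count false < rowSum A c (q.count true)) h hQ hQt hQ' hQt'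
    rfl
  rw [← hinj.ncard_image]
  congr 1
  ext ⟨c, P⟩
  simp only [Set.mem_image, Finset.coe_sigma, Set.mem_sigma_iff, Finset.mem_coe,
    Finset.mem_univ, Finset.mem_filter, mem_words, true_and, dominated_iff_prefix]
  constructor
  · rintro ⟨⟨c, Q, F⟩, ⟨-, hQt, rfl, rfl⟩, h⟩
    simp only [Sigma.mk.injEq, heq_eq_eq] at h
    obtain ⟨rfl, rfl⟩ := h
    refine ⟨⟨by simp, by simp; ring⟩, fun h => ?_⟩
    exact (h (Q ++ [true]) ⟨F, by simp⟩).not_gt hQt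
  · rintro ⟨⟨hf, ht⟩, h⟩
    push Not at h
    obtain ⟨Q, u, F, rfl, hQ, hu⟩ := exists_first_passage
      (fun q => q.count false < rowSum A c (q.count true)) (by simp [rowSum_zero]) h
    cases u with
    | false =>
      have := hQ Q (List.prefix_refl Q)
      simp only [List.count_append, List.count_singleton] at hu
      simp at hu
      omega
    | true =>
      refine ⟨⟨c, Q, F⟩, ⟨hQ, hu, ?_, ?_⟩, rfl⟩
      · simpa using hf
      · simp at ht
        simp only
        omega

theorem ncard_crossings_eq_mul {m : ℕ} [NeZero m] (A : ZMod m → ℕ) (k l : ℕ)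
    (hA : ∀ c, rowSum A c (l + 1) ≤ k + 1) :
    (crossings A k l).ncard = (∑ t, A t) * (words (k + 1) l).card := by
  have hcard : (∑ t, A t) * (words (k + 1) l).card =
      ((Finset.univ.sigma fun t : ZMod m => Finset.range (A t)) ×ˢ words (k + 1) l).card := by
    simp [Finset.card_product, Finset.card_sigma]
  -- Reversing the part before the crossing turns it into a first passage, backwards along the
  -- boundary, from the unit step of the boundary at which the crossing takes place.
  have hrev : ∀ x ∈ crossings A k l, ∃ i, x.2.1.count false = rowSum A x.1 (x.2.1.count true) + i ∧
      i < A (x.1 + x.2.1.count true) ∧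
      (∀ q, q <+: x.2.1.reverse → ¬ i + rowSum A (x.1 + x.2.1.count true - q.count true)
        (q.count true) < q.count false) := by
    rintro ⟨c, Q, F⟩ ⟨hQ, hQt, -⟩
    obtain ⟨i, hi⟩ := Nat.exists_eq_add_of_le (not_lt.mp (hQ Q (List.prefix_refl Q)))
    refine ⟨i, hi, ?_, ?_⟩
    · simp [rowSum_succ] at hQt
      dsimp only at hi ⊢
      omega
    · rintro q ⟨r, hr⟩
      obtain rfl : Q = r.reverse ++ q.reverse := by
        rw [← List.reverse_append, hr, List.reverse_reverse]
      have h := hQ r.reverse ⟨q.reverse, rfl⟩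
      simp only [List.count_append, List.count_reverse, rowSum_add, Nat.cast_add] at h hi ⊢
      rw [show c + (r.count true + q.count true) - q.count true = c + (r.count true : ZMod m) by
        ring]
      omega
  have hinj : Set.InjOn (fun x : ZMod m × List Bool × List Bool =>
      ((⟨x.1 + x.2.1.count true, x.2.1.count false - rowSum A x.1 (x.2.1.count true)⟩,
        x.2.1.reverse ++ false :: x.2.2) : (Σ _ : ZMod m, ℕ) × List Bool)) (crossings A k l) := by
    rintro ⟨c, Q, F⟩ hx ⟨c', Q', F'⟩ hx' h
    obtain ⟨i, hi, -, hpre⟩ := hrev _ hx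
    obtain ⟨i', hi', -, hpre'⟩ := hrev _ hx'
    simp only [Prod.mk.injEq, Sigma.mk.injEq, heq_eq_eq] at h hi hi' hpre hpre'
    obtain ⟨⟨hc, hii⟩, h⟩ := h
    obtain rfl : i = i' := by omega
    rw [← hc] at hpre'
    obtain ⟨hQ, rfl⟩ := first_passage_unique
      (fun q => i + rowSum A (c + Q.count true - q.count true) (q.count true) < q.count false)
      h hpre (by simp; omega) hpre' (by
        simp only [hc, List.count_append, List.count_reverse]
        simp
        omega)
    obtain rfl := List.reverse_injective hQ
    simpa using hc
  rw [hcard, ← Set.ncard_coe_finset, ← hinj.ncard_image]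
  congr 1
  ext ⟨⟨t, i⟩, W⟩
  simp only [Set.mem_image, Finset.coe_product, Set.mem_prod, Finset.mem_coe,
    Finset.mem_sigma, Finset.mem_univ, Finset.mem_range, mem_words, true_and]
  constructor
  · rintro ⟨⟨c, Q, F⟩, hx, h⟩
    obtain ⟨j, hj, hjA, -⟩ := hrev _ hx
    obtain ⟨-, -, rfl, rfl⟩ := hx
    simp only [Prod.mk.injEq, Sigma.mk.injEq, heq_eq_eq] at h hj hjA
    obtain ⟨⟨rfl, rfl⟩, rfl⟩ := h
    refine ⟨by omega, by simp; ring, by simp⟩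
  · rintro ⟨hi, hf, ht⟩
    obtain ⟨V, u, F, rfl, hV, hu⟩ := exists_first_passage
      (fun q => i + rowSum A (t - q.count true) (q.count true) < q.count false) (by simp)
      ⟨W, List.prefix_refl W, by
        have := hA (t - l)
        rw [rowSum_succ, sub_add_cancel] at this
        simp only [hf, ht]
        omega⟩
    have hVV := hV V (List.prefix_refl V)
    cases u with
    | true =>
      simp only [List.count_append, List.count_singleton] at hu
      simp at hu
      rw [add_comm (V.count true), rowSum_add] at hu
      rw [show t - (V.count true + 1 : ZMod m) + (1 : ℕ) = t - V.count true by push_cast; ring]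
        at hu
      omega
    | false =>
      simp only [List.count_append, List.count_singleton] at hu
      simp at hu hf ht
      have hVf : V.count false = i + rowSum A (t - V.count true) (V.count true) := by omega
      refine ⟨⟨t - V.count true, V.reverse, F⟩, ⟨?_, ?_, ?_, ?_⟩, ?_⟩
      · rintro q ⟨r, hr⟩
        obtain rfl : V = r.reverse ++ q.reverse := by
          rw [← List.reverse_append, hr, List.reverse_reverse]
        have h := hV r.reverse ⟨q.reverse, rfl⟩
        simp only [List.count_append, List.count_reverse, Nat.cast_add] at h hVf ⊢
        rw [add_comm (r.count true), rowSum_add] at hVf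
        rw [show t - (r.count true + q.count true : ZMod m) + q.count true = t - r.count true by
          ring] at hVf
        omega
      · simp [rowSum_succ]
        omega
      · simp
        omega
      · simpa using ht
      · simp [hVf]

theorem sum_range_natCast_zmod {m : ℕ} [NeZero m] {M : Type*} [AddCommMonoid M]
    (f : ZMod m → M) : ∑ j ∈ Finset.range m, f j = ∑ c, f c := by
  refine Finset.sum_bij' (fun j _ => (j : ZMod m)) (fun c _ => c.val) ?_ ?_ ?_ ?_ ?_
  · simp
  · intro c _
    simpa using c.val_lt
  · intro j hj
    exact ZMod.val_cast_of_lt (Finset.mem_range.mp hj)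
  · simp
  · simp

theorem sum_D_add {m : ℕ} [NeZero m] (A : ZMod m → ℕ) (k l : ℕ)
    (hA : ∀ c, rowSum A c (l + 1) ≤ k + 1) :
    ∑ c, D (fun i => A (c + i)) k (l + 1) + (∑ t, A t) * (k + (l + 1)).choose l =
      m * (k + (l + 1)).choose (l + 1) := by
  classical
  have h := ncard_crossings_eq_mul A k l hA
  rw [ncard_crossings_eq_sum, card_words, show k + 1 + l = k + (l + 1) by ring] at h
  rw [← h, ← Finset.sum_add_distrib]
  simp only [D_eq_card_filter, Finset.card_filter_add_card_filter_not, card_words]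
  simp [ZMod.card]

theorem D_zero (b : ℕ → ℕ) (k : ℕ) : D b k 0 = 1 := by
  classical
  rw [D_eq_card_filter, Finset.filter_true_of_mem, card_words]
  · simp
  · rintro P hP q r rfl
    simp [mem_words] at hP

theorem shiftComp_eq {m j : ℕ} (a : ℕ → ℕ) (hj : j < m) :
    shiftComp m j a = fun i : ℕ => a ((-(j : ZMod m) + (i : ZMod m)).val) := by
  funext i
  rw [shiftComp, ← ZMod.val_natCast]
  congr 2
  push_cast [hj.le]
  simp
  ring

theorem stmt1 (m n k l : ℕ) (hm : 0 < m) (a : ℕ → ℕ)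
    (hsum : ∑ i ∈ Finset.range m, a i = n)
    (hk : k ≤ n) (hl : l ≤ m)
    (hbd : ∀ j < m, ∑ i ∈ Finset.range l, a ((j + i) % m) ≤ k + 1) :
    ((∑ j ∈ Finset.range m, D (shiftComp m j a) k l : ℕ) : ℤ) =
      (m : ℤ) * (k + l).choose l - (n : ℤ) * chooseInt (k + l) ((l : ℤ) - 1) := by
  have : NeZero m := ⟨hm.ne'⟩
  rcases l with _ | l
  · simp [D_zero, chooseInt]
  set A : ZMod m → ℕ := fun c => a c.val with hA
  have hsumA : ∑ t, A t = n := by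
    rw [← sum_range_natCast_zmod, ← hsum]
    refine Finset.sum_congr rfl fun j hj => ?_
    simp only [hA, ZMod.val_cast_of_lt (Finset.mem_range.mp hj)]
  have hsumD : ∑ j ∈ Finset.range m, D (shiftComp m j a) k (l + 1) =
      ∑ c, D (fun i => A (c + i)) k (l + 1) := by
    rw [← Equiv.sum_comp (Equiv.neg (ZMod m)), ← sum_range_natCast_zmod]
    refine Finset.sum_congr rfl fun j hj => ?_
    rw [shiftComp_eq a (Finset.mem_range.mp hj)]
    rfl
  have h := sum_D_add A k l fun c => by
    refine le_of_eq_of_le (Finset.sum_congr rfl fun i _ => ?_) (hbd c.val c.val_lt)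
    rw [hA, ← ZMod.val_natCast]
    simp
  rw [hsumA, ← hsumD] at h
  have hchoose : chooseInt (k + (l + 1)) (((l + 1 : ℕ) : ℤ) - 1) = (k + (l + 1)).choose l := by
    simp [chooseInt]
  rw [hchoose]
  zify at h
  push_cast at h ⊢
  linarith
end

section
/- Let m be a positive integer and let a = (a_0, …, a_{m−1}) be nonnegative integers with a_0 + ⋯ + a_{m−1} = n. Then Σ_{j=0}^{m−1} D(σ^j(a), (n,m)) = binomial(n+m, m−1). -/
open Finset

theorem dominated_append_false (b : ℕ → ℕ) (P : List Bool) :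
    Dominated b (P ++ [false]) ↔ Dominated b P := by
  constructor
  · intro h q r hP
    exact h q (r ++ [false]) (by simp [hP])
  · intro h q r hP
    rcases List.eq_nil_or_concat r with rfl | ⟨r', x, rfl⟩
    · simpa using List.append_inj_right' hP rfl
    · rw [List.concat_eq_append, ← List.cons_append, ← List.append_assoc] at hP
      exact h q r' (List.append_inj_left' hP rfl)

theorem dominated_append_true (b : ℕ → ℕ) (P : List Bool) :
    Dominated b (P ++ [true]) ↔
      Dominated b P ∧ ∑ i ∈ range (P.count true + 1), b i ≤ P.count false := by
  constructor
  · intro h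
    exact ⟨fun q r hP => h q (r ++ [true]) (by simp [hP]), h P [] rfl⟩
  · rintro ⟨h, hP'⟩ q r hP
    rcases List.eq_nil_or_concat r with rfl | ⟨r', x, rfl⟩
    · rwa [← List.append_inj_left' hP rfl]
    · rw [List.concat_eq_append, ← List.cons_append, ← List.append_assoc] at hP
      exact h q r' (List.append_inj_left' hP rfl)

theorem dominated_append_replicate_false (b : ℕ → ℕ) (P : List Bool) (k : ℕ) :
    Dominated b (P ++ List.replicate k false) ↔ Dominated b P := by
  induction k with
  | zero => simp
  | succ k ih =>
    rw [List.replicate_succ', ← List.append_assoc, dominated_append_false, ih]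

/-- The lattice path with `m` U-steps, the `(i+1)`-st of which is immediately preceded by exactly
`c i` R-steps. -/
def pathOfRuns (c : ℕ → ℕ) : ℕ → List Bool
  | 0 => []
  | m + 1 => pathOfRuns c m ++ List.replicate (c m) false ++ [true]

theorem count_false_pathOfRuns (c : ℕ → ℕ) (m : ℕ) :
    (pathOfRuns c m).count false = ∑ i ∈ range m, c i := by
  induction m with
  | zero => rfl
  | succ m ih => simp [pathOfRuns, ih, sum_range_succ]

theorem count_true_pathOfRuns (c : ℕ → ℕ) (m : ℕ) : (pathOfRuns c m).count true = m := by
  induction m with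
  | zero => rfl
  | succ m ih => simp [pathOfRuns, ih, List.count_replicate]

theorem pathOfRuns_congr {c c' : ℕ → ℕ} {m : ℕ} (h : ∀ i < m, c i = c' i) :
    pathOfRuns c m = pathOfRuns c' m := by
  induction m with
  | zero => rfl
  | succ m ih => rw [pathOfRuns, pathOfRuns, ih fun i hi => h i (by omega), h m (by omega)]

theorem dominated_pathOfRuns (b c : ℕ → ℕ) (m : ℕ) :
    Dominated b (pathOfRuns c m) ↔
      ∀ d < m, ∑ i ∈ range (d + 1), b i ≤ ∑ i ∈ range (d + 1), c i := by
  induction m with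
  | zero => simp [pathOfRuns, Dominated]
  | succ m ih =>
    rw [pathOfRuns, dominated_append_true, dominated_append_replicate_false, ih,
      Nat.forall_lt_succ_right]
    simp [count_false_pathOfRuns, count_true_pathOfRuns, List.count_replicate, sum_range_succ]

theorem eq_of_pathOfRuns_eq {c c' : ℕ → ℕ} {m : ℕ} (h : pathOfRuns c m = pathOfRuns c' m) :
    ∀ i < m, c i = c' i := by
  have h₁ := (dominated_pathOfRuns c c' m).1 (h ▸ (dominated_pathOfRuns c c m).2 fun _ _ => le_rfl)
  have h₂ := (dominated_pathOfRuns c' c m).1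
    (h ▸ (dominated_pathOfRuns c' c' m).2 fun _ _ => le_rfl)
  have h₃ : ∀ d ≤ m, ∑ i ∈ range d, c i = ∑ i ∈ range d, c' i := by
    rintro (_ | d) hd
    · rfl
    · exact le_antisymm (h₁ d hd) (h₂ d hd)
  intro i hi
  have := h₃ (i + 1) hi
  rw [sum_range_succ, sum_range_succ, h₃ i hi.le] at this
  omega

theorem exists_eq_pathOfRuns_append (P : List Bool) :
    ∃ (c : ℕ → ℕ) (m k : ℕ), (∀ i, m ≤ i → c i = 0) ∧
      P = pathOfRuns c m ++ List.replicate k false := by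
  induction P using List.reverseRecOn with
  | nil => exact ⟨0, 0, 0, by simp, rfl⟩
  | append_singleton P x ih =>
    obtain ⟨c, m, k, hc, rfl⟩ := ih
    cases x
    · exact ⟨c, m, k + 1, hc, by rw [List.replicate_succ', List.append_assoc]⟩
    · refine ⟨Function.update c m k, m + 1, 0, fun i hi => ?_, ?_⟩
      · rw [Function.update_of_ne (by omega), hc i (by omega)]
      · rw [pathOfRuns, Function.update_self,
          pathOfRuns_congr (c := Function.update c m k) (c' := c)
            fun i hi => Function.update_of_ne (by omega) _ _]
        simp

theorem D_eq_card_filter_piAntidiag {b : ℕ → ℕ} {m n : ℕ} (hm : 0 < m)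
    (hb : ∑ i ∈ range m, b i = n) :
    D b n m = #{c ∈ piAntidiag (range m) n |
      ∀ d < m, ∑ i ∈ range (d + 1), b i ≤ ∑ i ∈ range (d + 1), c i} := by
  rw [D, ← Nat.card_eq_finsetCard]
  have hpath (c : ℕ → ℕ) (hc : c ∈ {c ∈ piAntidiag (range m) n |
      ∀ d < m, ∑ i ∈ range (d + 1), b i ≤ ∑ i ∈ range (d + 1), c i}) :
      (pathOfRuns c m).count false = n ∧ (pathOfRuns c m).count true = m ∧
        Dominated b (pathOfRuns c m) := by
    rw [mem_filter, mem_piAntidiag] at hc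
    exact ⟨(count_false_pathOfRuns c m).trans hc.1.1, count_true_pathOfRuns c m,
      (dominated_pathOfRuns b c m).2 hc.2⟩
  refine (Nat.card_eq_of_bijective (fun c => ⟨pathOfRuns c.1 m, hpath c.1 c.2⟩)
    ⟨fun c c' h => ?_, fun P => ?_⟩).symm
  · have hs := (mem_piAntidiag.1 (mem_filter.1 c.2).1).2
    have hs' := (mem_piAntidiag.1 (mem_filter.1 c'.2).1).2
    ext i
    by_cases hi : i < m
    · exact eq_of_pathOfRuns_eq (congrArg Subtype.val h) i hi
    · rw [not_imp_comm.1 (hs i) (by simpa using hi), not_imp_comm.1 (hs' i) (by simpa using hi)]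
  · obtain ⟨P, hfalse, htrue, hdom⟩ := P
    obtain ⟨c, l, k, hc, rfl⟩ := exists_eq_pathOfRuns_append P
    obtain rfl : l = m := by simpa [count_true_pathOfRuns, List.count_replicate] using htrue
    replace hfalse : ∑ i ∈ range l, c i + k = n := by
      simpa [count_false_pathOfRuns] using hfalse
    have hle := hdom
    rw [dominated_append_replicate_false, dominated_pathOfRuns] at hle
    have hlast := hle (l - 1) (by omega)
    rw [Nat.sub_add_cancel hm] at hlast
    obtain rfl : k = 0 := by omega
    refine ⟨⟨c, mem_filter.2 ⟨mem_piAntidiag.2 ⟨hfalse, fun i hi => ?_⟩, hle⟩⟩, by simp⟩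
    by_contra h
    exact hi (hc i (by simpa using h))

theorem card_filter_le_eq_card_filter_lt (b : ℕ → ℕ) {m : ℕ} (n : ℕ) (hm : 0 < m) :
    #{c ∈ piAntidiag (range m) n |
      ∀ d < m, ∑ i ∈ range (d + 1), b i ≤ ∑ i ∈ range (d + 1), c i} =
    #{e ∈ piAntidiag (range m) (n + 1) |
      ∀ d < m, ∑ i ∈ range (d + 1), b i < ∑ i ∈ range (d + 1), e i} := by
  refine card_nbij' (· + Pi.single 0 1) (· - Pi.single 0 1) ?_ ?_ ?_ ?_
  · intro c hc
    simp only [coe_filter, mem_piAntidiag, Set.mem_ofPred_eq] at hc ⊢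
    obtain ⟨⟨hsum, hsupp⟩, hdom⟩ := hc
    refine ⟨⟨?_, fun i hi => ?_⟩, fun d hd => ?_⟩
    · simp [sum_add_distrib, hsum, hm]
    · rcases Nat.eq_zero_or_pos i with rfl | h
      · simpa using hm
      · exact hsupp i (by simpa [Pi.single_apply, h.ne'] using hi)
    · simpa [sum_add_distrib, Nat.lt_succ_iff] using hdom d hd
  · intro e he
    simp only [coe_filter, mem_piAntidiag, Set.mem_ofPred_eq] at he ⊢
    obtain ⟨⟨hsum, hsupp⟩, hdom⟩ := he
    have h₀ : 0 < e 0 := by simpa using (Nat.zero_le _).trans_lt (hdom 0 hm)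
    have hd (d : ℕ) : ∑ i ∈ range (d + 1), e i =
        ∑ i ∈ range (d + 1), (e - Pi.single 0 1 : ℕ → ℕ) i + 1 := by
      rw [sum_range_succ', sum_range_succ']
      simp
      omega
    refine ⟨⟨?_, fun i hi => hsupp i ?_⟩, fun d hdm => ?_⟩
    · have := hd (m - 1)
      rw [Nat.sub_add_cancel hm, hsum] at this
      exact (Nat.succ.inj this).symm
    · rw [Pi.sub_apply] at hi
      omega
    · have := hdom d hdm
      rw [hd] at this
      omega
  · intro c _
    simp
  · intro e he
    simp only [coe_filter, mem_piAntidiag, Set.mem_ofPred_eq] at he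
    have h₀ : 0 < e 0 := by simpa using (Nat.zero_le _).trans_lt (he.2 0 hm)
    ext i
    rcases Nat.eq_zero_or_pos i with rfl | h
    · simp
      omega
    · simp [h.ne']

theorem sum_range_add_of_periodic {M : Type*} [AddCommMonoid M] [IsRightCancelAdd M]
    {f : ℕ → M} {m : ℕ} (hf : Function.Periodic f m) (k : ℕ) :
    ∑ i ∈ range m, f (i + k) = ∑ i ∈ range m, f i := by
  induction k with
  | zero => rfl
  | succ k ih =>
    rw [← ih]
    apply add_right_cancel (b := f k)
    have := sum_range_succ' (fun i => f (i + k)) m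
    rw [sum_range_succ, Nat.add_comm m k, hf k] at this
    simp only [zero_add] at this
    rw [this]
    congr! 3
    ring

/-- The cycle lemma: an integer sequence of period `m` and sum `1` over a period has exactly one
cyclic shift all of whose partial sums are positive. -/
theorem existsUnique_shift_sum_pos {f : ℕ → ℤ} {m : ℕ} (hm : 0 < m) (hf : Function.Periodic f m)
    (hsum : ∑ i ∈ range m, f i = 1) :
    ∃! j, j < m ∧ ∀ d < m, 0 < ∑ i ∈ range (d + 1), f (i + (m - j)) := by
  set F : ℕ → ℤ := fun k => ∑ i ∈ range k, f i with hF
  have hshift (k d : ℕ) : ∑ i ∈ range d, f (i + k) = F (k + d) - F k := by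
    rw [eq_sub_iff_add_eq', hF]
    simp only [sum_range_add, Nat.add_comm]
  have hFm (k : ℕ) : F (k + m) = F k + 1 := by
    have := hshift k m
    rw [sum_range_add_of_periodic hf, hsum] at this
    omega
  simp only [hshift]
  obtain ⟨k, hk, hmin⟩ := exists_min_image (Icc 1 m) (fun k => toLex (F k, OrderDual.toDual k))
    ⟨1, by simp; omega⟩
  simp only [mem_Icc, Prod.Lex.toLex_le_toLex] at hk hmin
  refine existsUnique_of_exists_of_unique ⟨m - k, by omega, fun d hd => ?_⟩ ?_
  · rw [Nat.sub_sub_self hk.2, sub_pos]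
    by_cases h : k + (d + 1) ≤ m
    · rcases hmin (k + (d + 1)) ⟨by omega, h⟩ with h | ⟨-, h⟩
      · exact h
      · rw [OrderDual.toDual_le_toDual] at h
        omega
    · have h₁ := hFm (k + (d + 1) - m)
      rw [Nat.sub_add_cancel (by omega)] at h₁
      have := hmin (k + (d + 1) - m) ⟨by omega, by omega⟩
      omega
  · have key (j j' : ℕ) (hjj : j < j') (hj' : j' < m)
        (h : ∀ d < m, 0 < F (m - j + (d + 1)) - F (m - j))
        (h' : ∀ d < m, 0 < F (m - j' + (d + 1)) - F (m - j')) : False := by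
      have h₁ := h' (j' - j - 1) (by omega)
      have h₂ := h (m - (j' - j) - 1) (by omega)
      have h₃ := hFm (m - j')
      rw [show m - j' + (j' - j - 1 + 1) = m - j by omega] at h₁
      rw [show m - j + (m - (j' - j) - 1 + 1) = m - j' + m by omega] at h₂
      omega
    rintro j j' ⟨hj, h⟩ ⟨hj', h'⟩
    rcases lt_trichotomy j j' with hlt | heq | hlt
    · exact (key j j' hlt hj' h h').elim
    · exact heq
    · exact (key j' j hlt hj h' h).elim

/-- Cyclic rotation by `k` of the first `m` values of a sequence, all later values being
replaced by `0`. -/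
def rotateBelow (m k : ℕ) (e : ℕ → ℕ) : ℕ → ℕ := fun i => if i < m then e ((i + k) % m) else 0

theorem rotateBelow_mem_piAntidiag {m n : ℕ} (k : ℕ) {e : ℕ → ℕ}
    (he : e ∈ piAntidiag (range m) n) : rotateBelow m k e ∈ piAntidiag (range m) n := by
  rw [mem_piAntidiag] at he ⊢
  refine ⟨?_, fun i hi => ?_⟩
  · rw [← he.1]
    calc ∑ i ∈ range m, rotateBelow m k e i = ∑ i ∈ range m, e ((i + k) % m) :=
          sum_congr rfl fun i hi => if_pos (mem_range.1 hi)
      _ = ∑ i ∈ range m, e (i % m) :=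
          sum_range_add_of_periodic (f := fun i => e (i % m)) (fun i => by simp) k
      _ = ∑ i ∈ range m, e i :=
          sum_congr rfl fun i hi => by rw [Nat.mod_eq_of_lt (mem_range.1 hi)]
  · by_contra h
    exact hi (if_neg (by simpa using h))

theorem rotateBelow_rotateBelow {m n k l : ℕ} (hkl : k + l = m) {e : ℕ → ℕ}
    (he : e ∈ piAntidiag (range m) n) : rotateBelow m k (rotateBelow m l e) = e := by
  ext i
  by_cases hi : i < m
  · have hmod : (i + k) % m < m := Nat.mod_lt _ (by omega)
    simp [rotateBelow, hi, hmod, add_assoc, hkl, Nat.mod_eq_of_lt hi]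
  · rw [rotateBelow, if_neg hi]
    exact (not_imp_comm.1 ((mem_piAntidiag.1 he).2 i) (by simpa using hi)).symm

theorem card_filter_shiftComp {m j : ℕ} (n : ℕ) (hj : j < m) (b : ℕ → ℕ) :
    #{e ∈ piAntidiag (range m) n |
      ∀ d < m, ∑ i ∈ range (d + 1), b i < ∑ i ∈ range (d + 1), e i} =
    #{e ∈ piAntidiag (range m) n |
      ∀ d < m, ∑ i ∈ range (d + 1), b i < ∑ i ∈ range (d + 1), shiftComp m j e i} := by
  have hrot (e : ℕ → ℕ) {d : ℕ} (hd : d < m) : ∑ i ∈ range (d + 1), rotateBelow m (m - j) e i =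
      ∑ i ∈ range (d + 1), shiftComp m j e i :=
    sum_congr rfl fun i hi => if_pos (by rw [mem_range] at hi; omega)
  refine card_nbij' (rotateBelow m j) (rotateBelow m (m - j)) ?_ ?_ ?_ ?_
  · intro e he
    simp only [coe_filter, Set.mem_ofPred_eq] at he ⊢
    refine ⟨rotateBelow_mem_piAntidiag _ he.1, fun d hd => ?_⟩
    rw [← hrot _ hd, rotateBelow_rotateBelow (by omega) he.1]
    exact he.2 d hd
  · intro e he
    simp only [coe_filter, Set.mem_ofPred_eq] at he ⊢
    refine ⟨rotateBelow_mem_piAntidiag _ he.1, fun d hd => ?_⟩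
    rw [hrot _ hd]
    exact he.2 d hd
  · intro e he
    exact rotateBelow_rotateBelow (by omega) (mem_filter.1 he).1
  · intro e he
    exact rotateBelow_rotateBelow (by omega) (mem_filter.1 he).1

theorem card_piAntidiag_nat {ι : Type*} [DecidableEq ι] (s : Finset ι) (n : ℕ) :
    #(piAntidiag s n) = (#s + n - 1).choose n := by
  rw [← card_finsuppAntidiag_nat_eq_choose]
  symm
  refine card_bij (fun f _ => f) (fun f hf => ?_) (fun f _ g _ h => DFunLike.coe_injective h)
    fun f hf => ⟨Finsupp.onFinset s f (mem_piAntidiag.1 hf).2, ?_, rfl⟩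
  · rw [mem_finsuppAntidiag] at hf
    exact mem_piAntidiag.2 ⟨hf.1, fun i hi => hf.2 (Finsupp.mem_support_iff.2 hi)⟩
  · exact mem_finsuppAntidiag.2 ⟨(mem_piAntidiag.1 hf).1, Finsupp.support_onFinset_subset⟩

theorem existsUnique_shiftComp_sum_lt {m n : ℕ} (hm : 0 < m) {a e : ℕ → ℕ}
    (ha : ∑ i ∈ range m, a i = n) (he : ∑ i ∈ range m, e i = n + 1) :
    ∃! j, j < m ∧ ∀ d < m,
      ∑ i ∈ range (d + 1), shiftComp m j a i < ∑ i ∈ range (d + 1), shiftComp m j e i := by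
  have h := existsUnique_shift_sum_pos (f := fun i => (e (i % m) : ℤ) - a (i % m)) hm
    (fun i => by simp) ?_
  · simp only [sum_sub_distrib, sub_pos] at h
    exact_mod_cast h
  · have hmod (g : ℕ → ℕ) : ∑ i ∈ range m, g (i % m) = ∑ i ∈ range m, g i :=
      sum_congr rfl fun i hi => by rw [Nat.mod_eq_of_lt (mem_range.1 hi)]
    rw [sum_sub_distrib, ← Nat.cast_sum, ← Nat.cast_sum, hmod, hmod, ha, he]
    simp

theorem sum_range_shiftComp (m j : ℕ) (a : ℕ → ℕ) :
    ∑ i ∈ range m, shiftComp m j a i = ∑ i ∈ range m, a i := by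
  refine (sum_range_add_of_periodic (f := fun i => a (i % m)) (fun i => by simp) (m - j)).trans ?_
  exact sum_congr rfl fun i hi => by rw [Nat.mod_eq_of_lt (mem_range.1 hi)]

theorem stmt2 (m n : ℕ) (hm : 0 < m) (a : ℕ → ℕ)
    (hsum : ∑ i ∈ Finset.range m, a i = n) :
    ∑ j ∈ Finset.range m, D (shiftComp m j a) n m = (n + m).choose (m - 1) := by
  calc ∑ j ∈ range m, D (shiftComp m j a) n m
      = ∑ j ∈ range m, #{e ∈ piAntidiag (range m) (n + 1) | ∀ d < m,
          ∑ i ∈ range (d + 1), shiftComp m j a i < ∑ i ∈ range (d + 1), shiftComp m j e i} :=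
        sum_congr rfl fun j hj => by
          rw [D_eq_card_filter_piAntidiag hm ((sum_range_shiftComp m j a).trans hsum),
            card_filter_le_eq_card_filter_lt _ _ hm, card_filter_shiftComp _ (mem_range.1 hj)]
    _ = ∑ e ∈ piAntidiag (range m) (n + 1), #{j ∈ range m | ∀ d < m,
          ∑ i ∈ range (d + 1), shiftComp m j a i < ∑ i ∈ range (d + 1), shiftComp m j e i} :=
        sum_card_bipartiteAbove_eq_sum_card_bipartiteBelow _
    _ = ∑ e ∈ piAntidiag (range m) (n + 1), 1 := by
        refine sum_congr rfl fun e he => ?_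
        obtain ⟨j, hj, huniq⟩ :=
          existsUnique_shiftComp_sum_lt hm hsum (mem_piAntidiag.1 he).1
        refine card_eq_one.2 ⟨j, ext fun i => ?_⟩
        rw [mem_filter, mem_range, mem_singleton]
        exact ⟨huniq i, fun h => h ▸ hj⟩
    _ = (n + m).choose (m - 1) := by
        rw [← card_eq_sum_ones, card_piAntidiag_nat, card_range,
          show m + (n + 1) - 1 = n + m by omega]
        exact Nat.choose_symm_of_eq_add (by omega)
end

section
/- (Generalized ballot theorem.) Let a, k, l be nonnegative integers with k ≥ a·l. Then the number of lattice paths from (0,0) with terminus (k,l) all of whose visited lattice points (x,y) satisfy x ≥ a·y (i.e. paths lying weakly below the line x = ay) equals ((k − a·l + 1)/(k+1))·binomial(k+l, l); equivalently, (k+1) times this number of paths equals (k − a·l + 1)·binomial(k+l, l). -/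
/-- The lattice paths with terminus `(k,l)` all of whose visited points satisfy `a·y ≤ x`. -/
def ballotPaths (a k l : ℕ) : Set (List Bool) :=
  {P | P.count false = k ∧ P.count true = l ∧
    ∀ p : List Bool, p <+: P → a * p.count true ≤ p.count false}

namespace ballotPaths

variable {a k l : ℕ} {P : List Bool}

theorem finite (a k l : ℕ) : (ballotPaths a k l).Finite := by
  refine (List.finite_length_eq Bool (k + l)).subset fun P hP => ?_
  obtain ⟨hk, hl, -⟩ := hP
  have := List.count_false_add_count_true P
  simp only [Set.mem_ofPred_eq]
  omega

theorem eq_empty (h : k < a * l) : ballotPaths a k l = ∅ := by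
  refine Set.eq_empty_of_forall_notMem fun P hP => ?_
  obtain ⟨hk, hl, hp⟩ := hP
  have := hp P (List.prefix_refl P)
  rw [hk, hl] at this
  omega

theorem nil_mem_iff : [] ∈ ballotPaths a k l ↔ k = 0 ∧ l = 0 := by
  simp +contextual [ballotPaths, eq_comm]

theorem concat_false_mem_iff (h : a * l ≤ k) :
    P ++ [false] ∈ ballotPaths a k l ↔ ∃ k', k = k' + 1 ∧ P ∈ ballotPaths a k' l := by
  simp only [ballotPaths, Set.mem_ofPred_eq, List.prefix_concat_iff, or_imp, forall_and,
    forall_eq, List.count_append]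
  simp only [List.count_singleton]
  constructor
  · rintro ⟨h1, h2, -, h4⟩
    exact ⟨P.count false, by simpa using h1.symm, rfl, by simpa using h2, h4⟩
  · rintro ⟨k', rfl, rfl, rfl, h4⟩
    exact ⟨by simp, by simp, by simpa using h, h4⟩

theorem concat_true_mem_iff (h : a * l ≤ k) :
    P ++ [true] ∈ ballotPaths a k l ↔ ∃ l', l = l' + 1 ∧ P ∈ ballotPaths a k l' := by
  simp only [ballotPaths, Set.mem_ofPred_eq, List.prefix_concat_iff, or_imp, forall_and,
    forall_eq, List.count_append]
  simp only [List.count_singleton]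
  constructor
  · rintro ⟨h1, h2, -, h4⟩
    exact ⟨P.count true, by simpa using h2.symm, by simpa using h1, rfl, h4⟩
  · rintro ⟨l', rfl, rfl, rfl, h4⟩
    exact ⟨by simp, by simp, by simpa using h, h4⟩

theorem ncard_zero_zero (a : ℕ) : (ballotPaths a 0 0).ncard = 1 := by
  rw [Set.ncard_eq_one]
  refine ⟨[], Set.ext fun P => ?_⟩
  rcases List.eq_nil_or_concat' P with rfl | ⟨Q, _ | _, rfl⟩
  · simp [nil_mem_iff]
  · simp [concat_false_mem_iff]
  · simp [concat_true_mem_iff]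

theorem ncard_succ_zero (a k : ℕ) :
    (ballotPaths a (k + 1) 0).ncard = (ballotPaths a k 0).ncard := by
  rw [← Set.ncard_image_of_injective (ballotPaths a k 0) (List.append_left_injective [false])]
  congr 1
  ext P
  rcases List.eq_nil_or_concat' P with rfl | ⟨Q, _ | _, rfl⟩
  · simp [nil_mem_iff]
  · simp [concat_false_mem_iff]
  · simp [concat_true_mem_iff]

theorem ncard_zero_succ (l : ℕ) :
    (ballotPaths 0 0 (l + 1)).ncard = (ballotPaths 0 0 l).ncard := by
  rw [← Set.ncard_image_of_injective (ballotPaths 0 0 l) (List.append_left_injective [true])]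
  congr 1
  ext P
  rcases List.eq_nil_or_concat' P with rfl | ⟨Q, _ | _, rfl⟩
  · simp [nil_mem_iff]
  · simp [concat_false_mem_iff]
  · simp [concat_true_mem_iff]

theorem ncard_succ_succ (h : a * (l + 1) ≤ k + 1) :
    (ballotPaths a (k + 1) (l + 1)).ncard =
      (ballotPaths a k (l + 1)).ncard + (ballotPaths a (k + 1) l).ncard := by
  rw [← Set.ncard_image_of_injective (ballotPaths a k (l + 1))
      (List.append_left_injective [false]),
    ← Set.ncard_image_of_injective (ballotPaths a (k + 1) l) (List.append_left_injective [true]),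
    ← Set.ncard_union_eq _ ((finite _ _ _).image _) ((finite _ _ _).image _)]
  · congr 1
    ext P
    rcases List.eq_nil_or_concat' P with rfl | ⟨Q, _ | _, rfl⟩
    · simp [nil_mem_iff]
    · simp [concat_false_mem_iff h]
    · simp [concat_true_mem_iff h]
  · rw [Set.disjoint_left]
    rintro _ ⟨P, -, rfl⟩ ⟨Q, -, hQ⟩
    simp at hQ

/-- The count also holds (as `0 = 0`) for terminus just beyond the boundary line. -/
theorem succ_mul_ncard (a k l : ℕ) (h : a * l ≤ k + 1) :
    ((k : ℤ) + 1) * (ballotPaths a k l).ncard = (k + 1 - a * l) * (k + l).choose l := by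
  have boundary {k l : ℕ} (h : a * l = k + 1) :
      ((k : ℤ) + 1) * (ballotPaths a k l).ncard = (k + 1 - a * l) * (k + l).choose l := by
    rw [eq_empty (by omega)]
    have : (a * l : ℤ) = k + 1 := mod_cast h
    simp [this]
  induction k generalizing l with
  | zero =>
    rcases h.eq_or_lt with h | h
    · exact boundary h
    have h0 : a * l = 0 := by omega
    have hn : (ballotPaths a 0 l).ncard = 1 := by
      induction l with
      | zero => exact ncard_zero_zero a
      | succ l ih =>
        obtain rfl : a = 0 := by simpa using h0
        rw [ncard_zero_succ, ih (by simp) (by simp) (by simp)]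
    have : (a * l : ℤ) = 0 := mod_cast h0
    simp [hn, this]
  | succ k ihk =>
    induction l with
    | zero =>
      have := ihk 0 (by simp)
      rw [ncard_succ_zero]
      simp at this ⊢
      have h1 : ((k : ℤ) + 1) ≠ 0 := by positivity
      have h2 : (ballotPaths a k 0).ncard = 1 := by
        simpa [h1] using this
      simp [h2]
    | succ l ihl =>
      rcases h.eq_or_lt with h | h
      · exact boundary h
      have hB := ihl (by rw [mul_add] at h; omega)
      have hA := ihk (l + 1) (by omega)
      have hC : ((k + l + 1).choose (l + 1) : ℤ) * (l + 1) = (k + l + 1).choose l * (k + 1) := by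
        have := Nat.choose_succ_right_eq (k + l + 1) l
        rw [show k + l + 1 - l = k + 1 by omega] at this
        exact_mod_cast this
      have hP := Nat.choose_succ_succ (k + l + 1) l
      rw [ncard_succ_succ (by omega), show k + 1 + (l + 1) = (k + l + 1).succ by omega, hP]
      rw [show k + (l + 1) = k + l + 1 by omega] at hA
      rw [show k + 1 + l = k + l + 1 by omega] at hB
      have h1 : ((k : ℤ) + 1) ≠ 0 := by positivity
      apply mul_left_cancel₀ h1
      push_cast at hA hB ⊢
      simp only [Nat.succ_eq_add_one]
      linear_combination (k + 2 : ℤ) * hA + (k + 1 : ℤ) * hB - (a : ℤ) * hC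

end ballotPaths


/-- Generalized ballot theorem: for `k ≥ a·l`, the number of lattice paths from `(0,0)`
with terminus `(k,l)` (paths are lists of steps, `false` = R-step `(1,0)`,
`true` = U-step `(0,1)`) all of whose visited lattice points `(x,y)` satisfy `x ≥ a·y`
equals `((k - a·l + 1)/(k+1))·C(k+l, l)`; stated in the equivalent multiplied form. -/
theorem stmt3 (a k l : ℕ) (h : a * l ≤ k) :
    (k + 1) * Nat.card {P : List Bool //
        P.count false = k ∧ P.count true = l ∧
        ∀ p : List Bool, p <+: P → a * p.count true ≤ p.count false} =
      (k - a * l + 1) * (k + l).choose l := by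
  have := ballotPaths.succ_mul_ncard a k l (by omega)
  change (k + 1) * (ballotPaths a k l).ncard = _
  zify [h]
  rw [this]
  ring
end

section
/- (Cycle Lemma.) Let m ≥ 0 and let i_0, i_1, …, i_m be integers with i_j ≤ 1 for every j and with positive sum k = i_0 + i_1 + ⋯ + i_m > 0. Then there are exactly k indices s with 0 ≤ s ≤ m such that the cyclic shift (i_s, i_{s+1}, …, i_{s+m}) (indices read modulo m+1) has all partial sums positive, i.e. i_s + i_{s+1} + ⋯ + i_{s+r} > 0 for every r with 0 ≤ r ≤ m. -/
/-- The minimum of a sequence over a window of `m + 1` consecutive indices. -/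
def windowMin (m : ℕ) (P : ℕ → ℤ) (s : ℕ) : ℤ :=
  (Finset.range (m + 1)).inf' Finset.nonempty_range_add_one (fun r => P (s + r))

theorem lt_windowMin_iff {m : ℕ} {P : ℕ → ℤ} {s : ℕ} {a : ℤ} :
    a < windowMin m P s ↔ ∀ r ≤ m, a < P (s + r) := by
  simp [windowMin, Finset.lt_inf'_iff]

theorem windowMin_le {m : ℕ} {P : ℕ → ℤ} {s r : ℕ} (hr : r ≤ m) :
    windowMin m P s ≤ P (s + r) :=
  Finset.inf'_le (fun r => P (s + r)) (by simpa using hr)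

theorem exists_windowMin_eq (m : ℕ) (P : ℕ → ℤ) (s : ℕ) :
    ∃ r ≤ m, windowMin m P s = P (s + r) := by
  obtain ⟨r, hr, h⟩ := Finset.exists_mem_eq_inf' (Finset.nonempty_range_add_one (n := m))
    (fun r => P (s + r))
  exact ⟨r, by simpa using hr, h⟩

/-- If the sequence increases over each period and has steps at most `1`, then the window minimum
increases by `1` where the sequence stays above its current value, and is constant elsewhere. -/
theorem windowMin_succ_sub {m : ℕ} {P : ℕ → ℤ} (hP : ∀ s, P s < P (s + (m + 1)))
    (hstep : ∀ s, P (s + 1) ≤ P s + 1) (s : ℕ) :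
    windowMin m P (s + 1) - windowMin m P s =
      if P s < windowMin m P (s + 1) then 1 else 0 := by
  have h0 : windowMin m P s ≤ P s := windowMin_le (r := 0) (Nat.zero_le m)
  have h1 : windowMin m P (s + 1) ≤ P (s + 1) := windowMin_le (r := 0) (Nat.zero_le m)
  have h2 := hstep s
  have hlow : windowMin m P s ≤ windowMin m P (s + 1) := by
    obtain ⟨r, hr, h⟩ := exists_windowMin_eq m P (s + 1)
    rw [h]
    rcases hr.lt_or_eq with hr | rfl
    · have := windowMin_le (m := m) (P := P) (s := s) (r := r + 1) hr
      rwa [show s + 1 + r = s + (r + 1) by omega]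
    · have := hP s
      rw [show s + 1 + r = s + (r + 1) by omega]
      omega
  have hup : windowMin m P s = P s ∨ windowMin m P (s + 1) ≤ windowMin m P s := by
    obtain ⟨r, hr, h⟩ := exists_windowMin_eq m P s
    rcases r with _ | r
    · exact Or.inl h
    · right
      rw [h, show s + (r + 1) = s + 1 + r by omega]
      exact windowMin_le (by omega)
  split_ifs <;> omega

/-- Cycle Lemma: given integers `i 0, …, i m` each at most `1` with positive total sum
`k`, exactly `k` of the cyclic shifts (starting positions `s` with `0 ≤ s ≤ m`, indices
read modulo `m+1`) have all partial sums positive. -/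
theorem stmt4 (m : ℕ) (i : ℕ → ℤ) (h1 : ∀ j ≤ m, i j ≤ 1)
    (k : ℤ) (hk : k = ∑ j ∈ Finset.range (m + 1), i j) (hkpos : 0 < k) :
    (((Finset.range (m + 1)).filter
        (fun s => ∀ r ≤ m, 0 < ∑ t ∈ Finset.range (r + 1), i ((s + t) % (m + 1)))).card : ℤ)
      = k := by
  set P : ℕ → ℤ := fun n => ∑ j ∈ Finset.range n, i (j % (m + 1))
  have hadd (s n : ℕ) :
      P (s + n) = P s + ∑ t ∈ Finset.range n, i ((s + t) % (m + 1)) :=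
    Finset.sum_range_add _ s n
  have hper (s : ℕ) : P (s + (m + 1)) = P s + k := by
    induction s with
    | zero =>
      have : P (m + 1) = k := by
        rw [hk]
        exact Finset.sum_congr rfl fun j hj => by
          rw [Nat.mod_eq_of_lt (Finset.mem_range.mp hj)]
      have h0 : P 0 = 0 := Finset.sum_range_zero _
      rw [zero_add, this, h0, zero_add]
    | succ s ih =>
      have e1 : P (s + (m + 1) + 1) = P (s + (m + 1)) + i ((s + (m + 1)) % (m + 1)) :=
        Finset.sum_range_succ _ _
      have e2 : P (s + 1) = P s + i (s % (m + 1)) := Finset.sum_range_succ _ _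
      rw [Nat.add_mod_right] at e1
      rw [show s + 1 + (m + 1) = s + (m + 1) + 1 by omega]
      omega
  have hstep (s : ℕ) : P (s + 1) ≤ P s + 1 := by
    have e : P (s + 1) = P s + i (s % (m + 1)) := Finset.sum_range_succ _ _
    have := h1 (s % (m + 1)) (Nat.lt_succ_iff.mp (Nat.mod_lt _ m.succ_pos))
    omega
  have hgood (s : ℕ) : (∀ r ≤ m, 0 < ∑ t ∈ Finset.range (r + 1), i ((s + t) % (m + 1))) ↔
      P s < windowMin m P (s + 1) := by
    rw [lt_windowMin_iff]
    refine forall₂_congr fun r _ => ?_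
    rw [show s + 1 + r = s + (r + 1) by omega, hadd]
    omega
  have htotal : windowMin m P (m + 1) = windowMin m P 0 + k := by
    obtain ⟨a, ha, hA⟩ := exists_windowMin_eq m P (m + 1)
    obtain ⟨b, hb, hB⟩ := exists_windowMin_eq m P 0
    have h3 := windowMin_le (P := P) (s := m + 1) hb
    have h4 := windowMin_le (P := P) (s := 0) ha
    have h5 := hper a
    have h6 := hper b
    rw [add_comm] at h5 h6
    rw [zero_add] at hB h4
    omega
  simp_rw [hgood]
  rw [Finset.card_filter]
  push_cast
  rw [← Finset.sum_congr rfl fun s _ =>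
    windowMin_succ_sub (fun s => by rw [hper]; omega) hstep s, Finset.sum_range_sub, htotal]
  omega
end

section
/- Fix integers a, b with 0 ≤ a < b and set c = a + b. For n ≥ 0 let q_n = (cn + b − 1, 2n + 1). Then the number of lattice paths from (0,0) with terminus q_n that lie weakly under ∂_{a,b} equals M_n = ((b−a)/(cn+b))·binomial((c+2)n + b, 2n + 1) (equivalently, (cn+b) times this count equals (b−a)·binomial((c+2)n+b, 2n+1)), and the number of lattice paths from (0,0) with terminus q_n that lie weakly under ∂_{b,a} equals 0. -/
/-- The `d`-th abscissa `s_d` of the infinite periodic boundary `∂_{u,v}`: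
`s_{2q} = q(u+v)` and `s_{2q+1} = q(u+v) + u`. -/
def stairAbscissa (u v d : ℕ) : ℕ :=
  (d / 2) * (u + v) + (if d % 2 = 1 then u else 0)

/-- A lattice path is a list of steps: `false` = R-step `(1,0)`, `true` = U-step `(0,1)`,
starting at the origin.  `UnderPeriodic u v P` says `P` lies weakly under the infinite
periodic boundary `∂_{u,v}`: for every `d` with `0 ≤ d <` (number of U-steps of `P`),
the number of R-steps of `P` preceding its `(d+1)`-st U-step is at least `s_{d+1}`. -/
def UnderPeriodic (u v : ℕ) (P : List Bool) : Prop :=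
  ∀ q r : List Bool, P = q ++ true :: r →
    stairAbscissa u v (q.count true + 1) ≤ q.count false

theorem stairAbscissa_succ_succ (u v d : ℕ) :
    stairAbscissa u v (d + 2) = stairAbscissa u v d + (u + v) := by
  have h1 : (d + 2) / 2 = d / 2 + 1 := by omega
  have h2 : (d + 2) % 2 = d % 2 := by omega
  rw [stairAbscissa, stairAbscissa, h1, h2]
  ring

theorem stairAbscissa_zero (u v : ℕ) : stairAbscissa u v 0 = 0 := by simp [stairAbscissa]

theorem stairAbscissa_one (u v : ℕ) : stairAbscissa u v 1 = u := by simp [stairAbscissa]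

theorem stairAbscissa_two (u v : ℕ) : stairAbscissa u v 2 = u + v := by simp [stairAbscissa]

theorem stairAbscissa_two_mul_add (u v m d : ℕ) :
    stairAbscissa u v (2 * m + d) = stairAbscissa u v d + (u + v) * m := by
  induction m with
  | zero => simp
  | succ m ih =>
    rw [show 2 * (m + 1) + d = 2 * m + d + 2 by ring, stairAbscissa_succ_succ, ih]
    ring

theorem stairAbscissa_le_succ (u v d : ℕ) :
    stairAbscissa u v d ≤ stairAbscissa u v (d + 1) := by
  obtain ⟨m, rfl | rfl⟩ := Nat.even_or_odd' d
  · have h0 := stairAbscissa_two_mul_add u v m 0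
    have h1 := stairAbscissa_two_mul_add u v m 1
    rw [stairAbscissa_zero, add_zero] at h0
    rw [stairAbscissa_one] at h1
    omega
  · have h1 := stairAbscissa_two_mul_add u v m 1
    have h2 := stairAbscissa_two_mul_add u v m 2
    rw [stairAbscissa_one] at h1
    rw [stairAbscissa_two] at h2
    rw [show 2 * m + 1 + 1 = 2 * m + 2 from rfl]
    omega

/-- Shifting the index of the boundary by an odd number of steps. -/
theorem stairAbscissa_add_odd (u v n d : ℕ) :
    stairAbscissa u v (d + (2 * n + 1)) =
      stairAbscissa u v d + (u + v) * n + (if Even d then u else v) := by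
  obtain ⟨m, rfl | rfl⟩ := Nat.even_or_odd' d
  · rw [show 2 * m + (2 * n + 1) = 2 * (m + n) + 1 by ring, ← Nat.add_zero (2 * m),
      stairAbscissa_two_mul_add, stairAbscissa_two_mul_add, stairAbscissa_one,
      stairAbscissa_zero, if_pos (by simp)]
    ring
  · rw [show 2 * m + 1 + (2 * n + 1) = 2 * (m + n) + 2 by ring,
      stairAbscissa_two_mul_add, stairAbscissa_two_mul_add, stairAbscissa_one,
      stairAbscissa_two, if_neg (by simp)]
    ring

/-- A path lies weakly under the boundary iff the terminus of each of its prefixes does. -/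
theorem underPeriodic_iff_prefix (u v : ℕ) (P : List Bool) :
    UnderPeriodic u v P ↔
      ∀ q, q <+: P → stairAbscissa u v (q.count true) ≤ q.count false := by
  constructor
  · intro h q
    induction q using List.reverseRecOn with
    | nil => simp [stairAbscissa]
    | append_singleton q x ih =>
      rintro ⟨r, rfl⟩
      have hq := ih ⟨x :: r, by simp⟩
      cases x with
      | false => simpa using hq.trans (Nat.le_succ _)
      | true => simpa using h q r (by simp)
  · rintro h q r rfl
    simpa using h (q ++ [true]) ⟨r, by simp⟩

/-- A sequence of integers rising by at most one per step and by `D` per period `T` has exactly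
`D` strict last passages in each period. -/
theorem card_strict_last_passage (h : ℕ → ℤ) (T D : ℕ) (hT : 0 < T) (hD : 0 < D)
    (hstep : ∀ j, h (j + 1) ≤ h j + 1) (hper : ∀ j, h (j + T) = h j + D)
    [DecidablePred fun j => ∀ q, j < q → h j < h q] :
    ((Finset.range T).filter fun j => ∀ q, j < q → h j < h q).card = D := by
  have hbdd : ∃ B, ∀ q, B ≤ h q := by
    obtain ⟨j₀, -, hj₀⟩ := Finset.exists_min_image (Finset.range T) h ⟨0, by simpa⟩
    refine ⟨h j₀, fun q => ?_⟩
    induction q using Nat.strong_induction_on with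
    | _ q ih =>
      by_cases hq : q < T
      · exact hj₀ q (by simpa)
      · have h1 := ih (q - T) (by omega)
        have h2 := hper (q - T)
        rw [Nat.sub_add_cancel (by omega)] at h2
        omega
  obtain ⟨B, hB⟩ := hbdd
  have hex : ∀ i, ∃ m, IsLeast (h '' Set.Ici i) m := by
    intro i
    obtain ⟨m, hm, hmin⟩ := Int.exists_least_of_bdd (P := fun z => z ∈ h '' Set.Ici i)
      ⟨B, by rintro z ⟨q, -, rfl⟩; exact hB q⟩ ⟨h i, i, Set.self_mem_Ici, rfl⟩
    exact ⟨m, hm, hmin⟩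
  choose A hA using hex
  have hAT : A (0 + T) = A 0 + D := by
    refine (hA _).unique ⟨?_, ?_⟩
    · obtain ⟨q, -, hq⟩ := (hA 0).1
      exact ⟨q + T, by simp, by rw [hper, hq]⟩
    · rintro _ ⟨q, hq, rfl⟩
      have hq' : 0 + T ≤ q := hq
      have h1 := hper (q - T)
      rw [Nat.sub_add_cancel (by omega)] at h1
      have h2 := (hA 0).2 ⟨q - T, by simp, rfl⟩
      omega
  have hinc : ∀ j, A (j + 1) - A j = if ∀ q, j < q → h j < h q then 1 else 0 := by
    intro j
    have hle : A (j + 1) ≤ h (j + 1) := (hA (j + 1)).2 ⟨j + 1, Set.self_mem_Ici, rfl⟩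
    have hs := hstep j
    split_ifs with hj
    · have h1 : A j = h j := by
        refine (hA j).unique ⟨⟨j, Set.self_mem_Ici, rfl⟩, ?_⟩
        rintro _ ⟨q, hq, rfl⟩
        rcases eq_or_lt_of_le (show j ≤ q from hq) with rfl | hq
        · exact le_rfl
        · exact (hj q hq).le
      obtain ⟨q, hq, hq'⟩ := (hA (j + 1)).1
      have := hj q hq
      omega
    · push Not at hj
      obtain ⟨q, hq, hq'⟩ := hj
      have h1 : A (j + 1) ≤ h q := (hA (j + 1)).2 ⟨q, hq, rfl⟩
      suffices A j = A (j + 1) by omega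
      refine (hA j).unique ⟨?_, ?_⟩
      · obtain ⟨p, hp, hp'⟩ := (hA (j + 1)).1
        exact ⟨p, (Nat.le_succ j).trans hp, hp'⟩
      · rintro _ ⟨p, hp, rfl⟩
        rcases eq_or_lt_of_le (show j ≤ p from hp) with rfl | hp
        · omega
        · exact (hA (j + 1)).2 ⟨p, hp, rfl⟩
  have hsum := Finset.sum_range_sub A T
  simp only [hinc, Finset.sum_boole] at hsum
  rw [Nat.zero_add] at hAT
  omega

/-- The cycle lemma for a periodic path with `2 * n + 1` up-steps and `(a + b) * n + b` right-steps
per period `L`: exactly `b - a` starting points in each period see a path staying strictly to the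
right of the boundary. -/
theorem card_good_starts (a b n L : ℕ) (hab : a < b) (hL : 0 < L) (u r : ℕ → ℕ)
    (hstep : ∀ j, (u (j + 1) = u j + 1 ∧ r (j + 1) = r j) ∨
      (u (j + 1) = u j ∧ r (j + 1) = r j + 1))
    (hu : ∀ j, u (j + L) = u j + (2 * n + 1))
    (hr : ∀ j, r (j + L) = r j + ((a + b) * n + b))
    [DecidablePred fun j => ∀ k, 0 < k → k ≤ L →
      stairAbscissa a b (u (j + k) - u j) + r j < r (j + k)] :
    ((Finset.range L).filter fun j => ∀ k, 0 < k → k ≤ L →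
      stairAbscissa a b (u (j + k) - u j) + r j < r (j + k)).card = b - a := by
  classical
  set G : ℕ → Prop := fun j => ∀ k, 0 < k → k ≤ L →
    stairAbscissa a b (u (j + k) - u j) + r j < r (j + k) with hG
  set h : ℕ → ℤ := fun j => (r j : ℤ) - stairAbscissa a b (u j) with hh
  have hmono : Monotone u := monotone_nat_of_le_succ fun j => by
    rcases hstep j with h | h <;> omega
  have hshift : ∀ j, h (j + L) = h j + if Even (u j) then ((b : ℤ) - a) else 0 := by
    intro j
    simp only [hh]
    rw [hu, hr, stairAbscissa_add_odd]
    split_ifs <;> push_cast <;> ring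
  have hper : ∀ j, h (j + (L + L)) = h j + ((b - a : ℕ) : ℤ) := by
    intro j
    rw [← add_assoc, hshift, hshift, hu, Nat.cast_sub hab.le]
    by_cases he : Even (u j)
    · rw [if_pos he, if_neg (by simp [he, parity_simps])]
      ring
    · rw [if_neg he, if_pos (by simp [he, parity_simps])]
      ring
  have hstep' : ∀ j, h (j + 1) ≤ h j + 1 := by
    intro j
    have hs := stairAbscissa_le_succ a b (u j)
    simp only [hh]
    rcases hstep j with ⟨h1, h2⟩ | ⟨h1, h2⟩ <;> rw [h1, h2] <;> push_cast <;> omega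
  have hGL : ∀ j, G (L + j) ↔ G j := by
    intro j
    refine forall_congr' fun k => imp_congr_right fun _ => imp_congr_right fun _ => ?_
    rw [show L + j + k = j + k + L by ring, add_comm L j, hu, hu, hr, hr,
      Nat.add_sub_add_right]
    omega
  have hEL : ∀ j, Even (u (L + j)) ↔ ¬ Even (u j) := by
    intro j
    rw [add_comm L j, hu]
    simp [parity_simps]
  have hGh : ∀ j, (∀ q, j < q → h j < h q) ↔ G j ∧ Even (u j) := by
    intro j
    have key : Even (u j) → ∀ k, h j < h (j + k) ↔
        stairAbscissa a b (u (j + k) - u j) + r j < r (j + k) := by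
      rintro he k
      obtain ⟨m, hm⟩ := he.two_dvd
      have h1 := stairAbscissa_two_mul_add a b m (u (j + k) - u j)
      have h2 := stairAbscissa_two_mul_add a b m 0
      have h3 := hmono (Nat.le_add_right j k)
      rw [← hm, Nat.add_sub_cancel' h3] at h1
      rw [← hm, add_zero, stairAbscissa_zero] at h2
      simp only [hh]
      omega
    constructor
    · intro hj
      have he : Even (u j) := by
        by_contra he
        have h1 := hj (j + L) (by omega)
        rw [hshift, if_neg he] at h1
        omega
      exact ⟨fun k hk _ => (key he k).1 (hj _ (by omega)), he⟩
    · rintro ⟨hg, he⟩ q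
      induction q using Nat.strong_induction_on with
      | _ q ih =>
        intro hq
        by_cases hqL : q ≤ j + L
        · have h1 := (key he (q - j)).2 (hg (q - j) (by omega) (by omega))
          rwa [Nat.add_sub_cancel' hq.le] at h1
        · have h1 := ih (q - L) (by omega) (by omega)
          have h2 := hshift (q - L)
          rw [Nat.sub_add_cancel (by omega)] at h2
          split_ifs at h2 <;> omega
  have hcount := card_strict_last_passage h (L + L) (b - a) (by omega) (by omega) hstep' hper
  simp only [hGh] at hcount
  suffices hS : ((Finset.range L).filter G).card = b - a by convert hS
  clear_value G
  rw [← hcount, Finset.card_filter, Finset.card_filter, Finset.sum_range_add,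
    ← Finset.sum_add_distrib]
  refine Finset.sum_congr rfl fun j _ => ?_
  simp only [hGL, hEL]
  by_cases h1 : G j <;> by_cases h2 : Even (u j) <;> simp [h1, h2]

theorem count_take_eq_natCount (l : List Bool) (x : Bool) (k : ℕ) :
    (l.take k).count x = Nat.count (fun i => l[i]? = some x) k := by
  induction k with
  | zero => simp
  | succ k ih =>
    rw [List.take_add_one, List.count_append, ih, Nat.count_succ]
    congr 1
    cases l[k]? <;> simp [List.count_singleton]

/-- Counts in prefixes of a rotation, read off the periodic extension of the word. -/
theorem natCount_add_rotate (w : List Bool) (x : Bool) (j k : ℕ) (hk : k ≤ w.length) :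
    Nat.count (fun i => w[i % w.length]? = some x) (j + k) =
      Nat.count (fun i => w[i % w.length]? = some x) j + ((w.rotate j).take k).count x := by
  rw [count_take_eq_natCount, Nat.count_add]
  congr 1
  rw [Nat.count_eq_card_filter_range, Nat.count_eq_card_filter_range]
  congr 1
  refine Finset.filter_congr fun i hi => ?_
  rw [List.getElem?_rotate (by have := Finset.mem_range.1 hi; omega), add_comm]

/-- The binary words of length `L` with exactly `k` letters `true`. -/
def binaryWords : ℕ → ℕ → Finset (List Bool)
  | 0, 0 => {[]}
  | 0, _ + 1 => ∅
  | L + 1, 0 => (binaryWords L 0).map ⟨List.cons false, List.cons_injective⟩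
  | L + 1, k + 1 =>
    (binaryWords L (k + 1)).map ⟨List.cons false, List.cons_injective⟩ ∪
      (binaryWords L k).map ⟨List.cons true, List.cons_injective⟩

theorem mem_binaryWords {L k : ℕ} {w : List Bool} :
    w ∈ binaryWords L k ↔ w.length = L ∧ w.count true = k := by
  induction w generalizing L k with
  | nil => cases L <;> cases k <;> simp [binaryWords]
  | cons x w ih => cases L <;> cases k <;> cases x <;> simp [binaryWords, ih]

theorem card_binaryWords (L k : ℕ) : (binaryWords L k).card = L.choose k := by
  induction L generalizing k with
  | zero => cases k <;> simp [binaryWords]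
  | succ L ih =>
    cases k with
    | zero => simp [binaryWords, ih]
    | succ k =>
      rw [binaryWords, Finset.card_union_of_disjoint, Finset.card_map, Finset.card_map, ih, ih,
        Nat.choose_succ_succ, add_comm]
      rw [Finset.disjoint_left]
      simp only [Finset.mem_map, Function.Embedding.coeFn_mk]
      rintro _ ⟨_, _, rfl⟩ ⟨_, _, h⟩
      simp at h

/-- Double counting over rotations: a property holding for exactly `D` rotations of each word. -/
theorem length_mul_card_filter_binaryWords (L k D : ℕ) (G : List Bool → Prop) [DecidablePred G]
    (hG : ∀ w ∈ binaryWords L k, ((Finset.range L).filter fun j => G (w.rotate j)).card = D) :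
    L * ((binaryWords L k).filter G).card = L.choose k * D := by
  have hrot : ∀ j, ((binaryWords L k).filter fun w => G (w.rotate j)).card =
      ((binaryWords L k).filter G).card := by
    intro j
    have himg : (binaryWords L k).image (fun w => w.rotate j) = binaryWords L k := by
      refine Finset.eq_of_subset_of_card_le ?_
        (Finset.card_image_of_injective _ (List.rotate_injective j)).ge
      intro w hw
      obtain ⟨v, hv, rfl⟩ := Finset.mem_image.1 hw
      rw [mem_binaryWords] at hv ⊢
      rwa [List.length_rotate, (List.rotate_perm v j).count_eq]
    conv_rhs => rw [← himg, Finset.filter_image,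
      Finset.card_image_of_injective _ (List.rotate_injective j)]
  calc L * ((binaryWords L k).filter G).card
      = ∑ j ∈ Finset.range L, ((binaryWords L k).filter fun w => G (w.rotate j)).card := by
        simp [hrot]
    _ = ∑ w ∈ binaryWords L k, ((Finset.range L).filter fun j => G (w.rotate j)).card := by
        simp only [Finset.card_filter]
        exact Finset.sum_comm
    _ = L.choose k * D := by
        rw [Finset.sum_congr rfl hG, Finset.sum_const, card_binaryWords, smul_eq_mul]

/-- Prepending an R-step to a path weakly under the boundary keeps all nonempty prefixes strictly
to the right of it, and every such nonempty word arises in this way. -/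
theorem strict_prefixes_iff (u v : ℕ) (w : List Bool) (hw : w ≠ []) :
    (∀ k, 0 < k → k ≤ w.length →
      stairAbscissa u v ((w.take k).count true) < (w.take k).count false) ↔
      ∃ P, UnderPeriodic u v P ∧ false :: P = w := by
  constructor
  · intro h
    obtain _ | ⟨x, P⟩ := w
    · exact absurd rfl hw
    cases x with
    | true => simpa using h 1 one_pos (by simp)
    | false =>
      refine ⟨P, (underPeriodic_iff_prefix u v P).2 ?_, rfl⟩
      rintro q ⟨r, rfl⟩
      have := h (q.length + 1) (by omega) (by simp)
      simpa [Nat.lt_succ_iff] using this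
  · rintro ⟨P, hP, rfl⟩ k hk _
    obtain ⟨k, rfl⟩ := Nat.exists_eq_add_of_lt hk
    have := (underPeriodic_iff_prefix u v P).1 hP (P.take k) (List.take_prefix _ _)
    simpa [Nat.lt_succ_iff] using this

/-- Exactly `b - a` rotations of a word with `2 * n + 1` U-steps and `(a + b) * n + b` R-steps
have all their nonempty prefixes strictly to the right of `∂_{a,b}`. -/
theorem card_strict_rotations (a b n : ℕ) (hab : a < b) (w : List Bool)
    (ht : w.count true = 2 * n + 1) (hf : w.count false = (a + b) * n + b)
    [DecidablePred fun j => ∀ k, 0 < k → k ≤ (w.rotate j).length →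
      stairAbscissa a b (((w.rotate j).take k).count true) < ((w.rotate j).take k).count false] :
    ((Finset.range w.length).filter fun j => ∀ k, 0 < k → k ≤ (w.rotate j).length →
      stairAbscissa a b (((w.rotate j).take k).count true) <
        ((w.rotate j).take k).count false).card = b - a := by
  classical
  have hL : 0 < w.length := by
    have := List.count_le_length (a := true) (l := w)
    omega
  have hper : ∀ x j, Nat.count (fun i => w[i % w.length]? = some x) (j + w.length) =
      Nat.count (fun i => w[i % w.length]? = some x) j + w.count x := by
    intro x j
    rw [natCount_add_rotate w x j _ le_rfl, List.take_of_length_le (by simp),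
      (List.rotate_perm w j).count_eq]
  rw [← card_good_starts a b n w.length hab hL
    (Nat.count fun i => w[i % w.length]? = some true)
    (Nat.count fun i => w[i % w.length]? = some false)
    (fun j => ?_) (fun j => by rw [hper, ht]) (fun j => by rw [hper, hf])]
  · congr 1
    refine Finset.filter_congr fun j _ => ?_
    rw [List.length_rotate]
    refine forall_congr' fun k => imp_congr_right fun _ => imp_congr_right fun hk => ?_
    rw [natCount_add_rotate w true j k hk, natCount_add_rotate w false j k hk,
      Nat.add_sub_cancel_left]
    omega
  · have hj : j % w.length < w.length := Nat.mod_lt _ hL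
    rw [Nat.count_succ, Nat.count_succ, List.getElem?_eq_getElem hj]
    cases w[j % w.length] <;> simp

theorem stmt9 (a b : ℕ) (hab : a < b) (c : ℕ) (hc : c = a + b) (n : ℕ) :
    (c * n + b) * Nat.card {P : List Bool //
        P.count false = c * n + b - 1 ∧ P.count true = 2 * n + 1 ∧
        UnderPeriodic a b P} =
      (b - a) * ((c + 2) * n + b).choose (2 * n + 1) ∧
    Nat.card {P : List Bool //
        P.count false = c * n + b - 1 ∧ P.count true = 2 * n + 1 ∧
        UnderPeriodic b a P} = 0 := by
  classical
  subst hc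
  constructor
  · set L := (a + b + 2) * n + b + 1 with hLdef
    have hLsum : L = ((a + b) * n + b) + (2 * n + 1) := by rw [hLdef]; ring
    set G : List Bool → Prop := fun w => ∀ k, 0 < k → k ≤ w.length →
      stairAbscissa a b ((w.take k).count true) < (w.take k).count false with hG
    have hcard : Nat.card {P : List Bool //
        P.count false = (a + b) * n + b - 1 ∧ P.count true = 2 * n + 1 ∧
        UnderPeriodic a b P} = ((binaryWords L (2 * n + 1)).filter G).card := by
      rw [← Set.ncard_coe_finset]
      refine Eq.trans ?_ (congrArg Set.ncard (?_ : List.cons false '' {P : List Bool |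
        P.count false = (a + b) * n + b - 1 ∧ P.count true = 2 * n + 1 ∧
        UnderPeriodic a b P} = _))
      · rw [Set.ncard_image_of_injective _ List.cons_injective]
        rfl
      · ext w
        simp only [Set.mem_image, Set.mem_ofPred_eq, Finset.coe_filter, mem_binaryWords]
        constructor
        · rintro ⟨P, ⟨hf, ht, hP⟩, rfl⟩
          have hlen := List.count_false_add_count_true P
          exact ⟨⟨by rw [List.length_cons]; omega, by simpa using ht⟩,
            (strict_prefixes_iff a b _ (by simp)).2 ⟨P, hP, rfl⟩⟩
        · rintro ⟨⟨hlen, ht⟩, hw⟩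
          obtain ⟨P, hP, rfl⟩ := (strict_prefixes_iff a b w (by rintro rfl; simp at ht)).1 hw
          have hsum := List.count_false_add_count_true P
          rw [List.length_cons] at hlen
          rw [List.count_cons_of_ne (by simp)] at ht
          exact ⟨P, ⟨by omega, ht, hP⟩, rfl⟩
    have hmain := length_mul_card_filter_binaryWords L (2 * n + 1) (b - a) G (by
      intro w hw
      obtain ⟨hlen, ht⟩ := mem_binaryWords.1 hw
      have hsum := List.count_false_add_count_true w
      rw [← hlen]
      exact card_strict_rotations a b n hab w ht (by omega))
    rw [hcard]
    have hchoose := Nat.choose_mul_succ_eq ((a + b + 2) * n + b) (2 * n + 1)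
    rw [← hLdef, show L - (2 * n + 1) = (a + b) * n + b by omega] at hchoose
    refine Nat.eq_of_mul_eq_mul_left (show 0 < L by omega) ?_
    calc L * (((a + b) * n + b) * ((binaryWords L (2 * n + 1)).filter G).card)
        = ((a + b) * n + b) * (L * ((binaryWords L (2 * n + 1)).filter G).card) := by ring
      _ = (b - a) * (L.choose (2 * n + 1) * ((a + b) * n + b)) := by rw [hmain]; ring
      _ = L * ((b - a) * ((a + b + 2) * n + b).choose (2 * n + 1)) := by rw [← hchoose]; ring
  · refine @Nat.card_of_isEmpty _ ⟨?_⟩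
    rintro ⟨P, hf, ht, hP⟩
    have h1 := (underPeriodic_iff_prefix b a P).1 hP P List.prefix_rfl
    rw [ht, hf, stairAbscissa_two_mul_add, stairAbscissa_one, add_comm b a] at h1
    omega
end

section
/- Fix integers a, b with 0 ≤ a < b and set c = a + b. For n ≥ 0 let p_n = (cn + b − a − 1, 2n), and let M_i = ((b−a)/(ci+b))·binomial((c+2)i + b, 2i + 1) and N_n = ((b−a)/(cn+b−a))·binomial((c+2)n + b − a − 1, 2n). Then the number of lattice paths from (0,0) with terminus p_n that lie weakly under ∂_{a,b} equals N_n + (1/2)·Σ_{i=0}^{n−1} M_i·M_{n−1−i}. -/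
/-- `M_i = ((b-a)/(ci+b)) · C((c+2)i + b, 2i+1)`. -/
noncomputable def Mq (a b c i : ℕ) : ℚ :=
  (((b : ℚ) - a) / ((c : ℚ) * i + b)) * (((c + 2) * i + b).choose (2 * i + 1) : ℚ)

/-- `N_n = ((b-a)/(cn+b-a)) · C((c+2)n + b - a - 1, 2n)`. -/
noncomputable def Nq (a b c n : ℕ) : ℚ :=
  (((b : ℚ) - a) / ((c : ℚ) * n + b - a)) * (((c + 2) * n + b - a - 1).choose (2 * n) : ℚ)

open Finset

namespace PeriodicPaths

/-! ### Rothe polynomials and their convolution identity -/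

/-- The Rothe polynomial `x / (x + β m) * C(x + β m + m - 1, m)`. -/
noncomputable def rothe (β : ℚ) : ℕ → Polynomial ℚ
  | 0 => 1
  | m + 1 => Polynomial.C (((m + 1).factorial : ℚ)⁻¹) * Polynomial.X *
      ∏ i ∈ range m, (Polynomial.X + Polynomial.C (β * (m + 1) + i + 1))

/-- The generating series `∑ rothe β m (x) t ^ m`. -/
noncomputable def rotheSeries (β x : ℚ) : PowerSeries ℚ :=
  PowerSeries.mk fun m => (rothe β m).eval x

lemma rothe_succ_eval (β x : ℚ) (m : ℕ) :
    (rothe β (m + 1)).eval x =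
      ((m + 1).factorial : ℚ)⁻¹ * x * ∏ i ∈ range m, (x + (β * (m + 1) + i + 1)) := by
  simp [rothe, Polynomial.eval_prod]

lemma rothe_sub (β x : ℚ) (m : ℕ) :
    (rothe β (m + 1)).eval x - (rothe β (m + 1)).eval (x - 1) = (rothe β m).eval (x + β) := by
  cases m with
  | zero => simp [rothe]
  | succ k =>
    have h1 : ∏ i ∈ range (k + 1), (x + (β * ((k + 1 : ℕ) + 1) + i + 1)) =
        (∏ i ∈ range k, (x + β + (β * (k + 1) + i + 1))) *
          (x + (β * (k + 2) + k + 1)) := by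
      rw [prod_range_succ]
      congr 1
      · refine prod_congr rfl fun i _ => ?_
        push_cast; ring
      · push_cast; ring
    have h2 : ∏ i ∈ range (k + 1), (x - 1 + (β * ((k + 1 : ℕ) + 1) + i + 1)) =
        (∏ i ∈ range k, (x + β + (β * (k + 1) + i + 1))) * (x + β * (k + 2)) := by
      rw [prod_range_succ']
      congr 1
      · refine prod_congr rfl fun i _ => ?_
        push_cast; ring
      · push_cast; ring
    rw [rothe_succ_eval, rothe_succ_eval, rothe_succ_eval, h1, h2,
      Nat.factorial_succ (k + 1)]
    have : ((k + 1).factorial : ℚ) ≠ 0 := by positivity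
    have : (k : ℚ) + 1 + 1 ≠ 0 := by positivity
    push_cast
    field_simp
    ring

lemma rotheSeries_sub (β x : ℚ) :
    rotheSeries β x - rotheSeries β (x - 1) = PowerSeries.X * rotheSeries β (x + β) := by
  ext m
  cases m with
  | zero => simp [rotheSeries, rothe]
  | succ k => simpa [rotheSeries, PowerSeries.coeff_succ_X_mul] using rothe_sub β x k

@[simp] lemma rotheSeries_zero (β : ℚ) : rotheSeries β 0 = 1 := by
  ext m
  cases m with
  | zero => simp [rotheSeries, rothe]
  | succ k => simp [rotheSeries, rothe_succ_eval, PowerSeries.coeff_one]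

@[simp] lemma constantCoeff_rotheSeries (β x : ℚ) :
    PowerSeries.constantCoeff (rotheSeries β x) = 1 := by
  rw [← PowerSeries.coeff_zero_eq_constantCoeff_apply]
  simp [rotheSeries, rothe]

/-- The Rothe–Hagen identity. -/
theorem rotheSeries_mul (β x y : ℚ) :
    rotheSeries β x * rotheSeries β y = rotheSeries β (x + y) := by
  ext m
  induction m generalizing x with
  | zero => simp [PowerSeries.coeff_zero_eq_constantCoeff_apply]
  | succ k ih =>
    let p : Polynomial ℚ := (∑ ij ∈ antidiagonal (k + 1),
      rothe β ij.1 * Polynomial.C ((rothe β ij.2).eval y)) -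
        (rothe β (k + 1)).comp (Polynomial.X + Polynomial.C y)
    have hp (z : ℚ) : p.eval z = PowerSeries.coeff (k + 1)
        (rotheSeries β z * rotheSeries β y - rotheSeries β (z + y)) := by
      simp [p, rotheSeries, PowerSeries.coeff_mul, Polynomial.eval_finsetSum]
    have hstep (z : ℚ) : p.eval z = p.eval (z - 1) := by
      rw [← sub_eq_zero, hp, hp, ← map_sub]
      have : rotheSeries β z * rotheSeries β y - rotheSeries β (z + y) -
          (rotheSeries β (z - 1) * rotheSeries β y - rotheSeries β (z - 1 + y)) =
          PowerSeries.X *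
            (rotheSeries β (z + β) * rotheSeries β y - rotheSeries β (z + β + y)) := by
        have h1 := rotheSeries_sub β z
        have h2 := rotheSeries_sub β (z + y)
        rw [show z + y - 1 = z - 1 + y by ring, show z + y + β = z + β + y by ring] at h2
        linear_combination rotheSeries β y * h1 - h2
      rw [this, PowerSeries.coeff_succ_X_mul, map_sub, ih, sub_self]
    have hnat (j : ℕ) : p.eval (j : ℚ) = 0 := by
      induction j with
      | zero => simp [hp]
      | succ j ihj => rw [hstep]; simpa using ihj
    have hzero : p = 0 := Polynomial.eq_zero_of_infinite_isRoot p <|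
      (Set.infinite_range_of_injective (Nat.cast_injective (R := ℚ))).mono <| by
        rintro _ ⟨j, rfl⟩
        exact hnat j
    have := hp x
    rw [hzero, Polynomial.eval_zero, map_sub] at this
    linarith

lemma rothe_eval_eq_choose (β x : ℚ) (m Y : ℕ) (hY : x + β * m = Y) (hpos : 0 < Y) :
    (rothe β m).eval x = x / Y * ((Y + m - 1).choose m : ℚ) := by
  have hY0 : (Y : ℚ) ≠ 0 := by positivity
  cases m with
  | zero =>
    have : x = Y := by simpa using hY
    simp [rothe, this, hY0]
  | succ k =>
    have hasc : (Y.ascFactorial (k + 1) : ℚ) =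
        (k + 1).factorial * ((Y + (k + 1) - 1).choose (k + 1) : ℚ) := by
      exact_mod_cast Nat.ascFactorial_eq_factorial_mul_choose' Y (k + 1)
    have hprod : (Y.ascFactorial (k + 1) : ℚ) =
        Y * ∏ i ∈ range k, (x + (β * (k + 1) + i + 1)) := by
      rw [Nat.ascFactorial_eq_prod_range, prod_range_succ']
      push_cast at hY ⊢
      rw [add_zero, mul_comm]
      congr 1
      refine prod_congr rfl fun i _ => ?_
      linear_combination -hY
    have hf : ((k + 1).factorial : ℚ) ≠ 0 := by positivity
    rw [rothe_succ_eval]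
    field_simp
    linear_combination x * hasc - x * hprod

/-! ### Even and odd parts of power series -/

/-- The substitution `t ↦ -t`. -/
noncomputable abbrev bar : PowerSeries ℚ →+* PowerSeries ℚ := PowerSeries.rescale (-1)

lemma bar_bar (f : PowerSeries ℚ) : bar (bar f) = f := by
  ext m
  simp only [PowerSeries.coeff_rescale]
  rw [← mul_assoc, ← mul_pow]
  simp

lemma coeff_bar_even (f : PowerSeries ℚ) (q : ℕ) :
    PowerSeries.coeff (2 * q) (bar f) = PowerSeries.coeff (2 * q) f := by
  simp [PowerSeries.coeff_rescale]

lemma coeff_bar_odd (f : PowerSeries ℚ) (q : ℕ) :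
    PowerSeries.coeff (2 * q + 1) (bar f) = -PowerSeries.coeff (2 * q + 1) f := by
  simp [PowerSeries.coeff_rescale, pow_succ]

lemma coeff_odd_eq_zero {f : PowerSeries ℚ} (h : bar f = f) (q : ℕ) :
    PowerSeries.coeff (2 * q + 1) f = 0 := by
  have := coeff_bar_odd f q
  rw [h] at this
  linarith

lemma sum_range_two_mul {M : Type*} [AddCommMonoid M] (F : ℕ → M) (n : ℕ) :
    ∑ k ∈ range (2 * n), F k = ∑ i ∈ range n, (F (2 * i) + F (2 * i + 1)) := by
  induction n with
  | zero => simp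
  | succ n ih => rw [mul_add, mul_one, sum_range_succ, sum_range_succ, sum_range_succ, ih, add_assoc]

lemma coeff_sub_bar_sq (f : PowerSeries ℚ) (n : ℕ) :
    PowerSeries.coeff (2 * n) ((f - bar f) ^ 2) =
      ∑ i ∈ range n, (2 * PowerSeries.coeff (2 * i + 1) f) *
        (2 * PowerSeries.coeff (2 * (n - 1 - i) + 1) f) := by
  have heven (q : ℕ) : PowerSeries.coeff (2 * q) (f - bar f) = 0 := by
    rw [map_sub, coeff_bar_even, sub_self]
  have hodd (q : ℕ) : PowerSeries.coeff (2 * q + 1) (f - bar f) =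
      2 * PowerSeries.coeff (2 * q + 1) f := by
    rw [map_sub, coeff_bar_odd]; ring
  rw [sq, PowerSeries.coeff_mul, Nat.sum_antidiagonal_eq_sum_range_succ_mk, sum_range_succ,
    sum_range_two_mul, heven, zero_mul, add_zero]
  refine sum_congr rfl fun i hi => ?_
  have hi := mem_range.1 hi
  rw [heven, zero_mul, zero_add, show 2 * n - (2 * i + 1) = 2 * (n - 1 - i) + 1 by omega,
    hodd, hodd]

/-! ### The series solving the boundary conditions -/

/-- The even series `2 / (η(t) + η(-t))`, where `η = rotheSeries β δ`. -/
noncomputable def evenSeries (β δ : ℚ) : PowerSeries ℚ :=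
  2 * (rotheSeries β δ + bar (rotheSeries β δ))⁻¹

lemma evenSeries_mul (β δ : ℚ) :
    evenSeries β δ * (rotheSeries β δ + bar (rotheSeries β δ)) = 2 := by
  rw [evenSeries, mul_assoc, PowerSeries.inv_mul_cancel, mul_one]
  rw [map_add, ← PowerSeries.coeff_zero_eq_constantCoeff_apply,
    ← PowerSeries.coeff_zero_eq_constantCoeff_apply, PowerSeries.coeff_rescale]
  norm_num

lemma bar_evenSeries (β δ : ℚ) : bar (evenSeries β δ) = evenSeries β δ := by
  have h := evenSeries_mul β δ
  have h' := congrArg bar h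
  rw [map_mul, map_add, bar_bar, map_ofNat] at h'
  have hne : rotheSeries β δ + bar (rotheSeries β δ) ≠ 0 := by
    intro h0
    rw [h0, mul_zero] at h
    have := congrArg PowerSeries.constantCoeff h
    rw [map_zero, map_ofNat] at this
    norm_num at this
  refine mul_right_cancel₀ hne ?_
  rw [h, add_comm, h']

/-- The rational number which, at `x = k + 1`, counts paths to `(k, m)`. -/
noncomputable def pathPoly (β δ : ℚ) (m : ℕ) (x : ℚ) : ℚ :=
  PowerSeries.coeff m (rotheSeries β δ * evenSeries β δ * rotheSeries β (x - β * m))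

lemma pathPoly_zero (β δ x : ℚ) : pathPoly β δ 0 x = 1 := by
  have h := congrArg PowerSeries.constantCoeff (evenSeries_mul β δ)
  have hb : PowerSeries.constantCoeff (bar (rotheSeries β δ)) = 1 := by
    rw [← PowerSeries.coeff_zero_eq_constantCoeff_apply, PowerSeries.coeff_rescale]
    simp
  rw [map_mul, map_add, hb, constantCoeff_rotheSeries, map_ofNat] at h
  rw [pathPoly, PowerSeries.coeff_zero_eq_constantCoeff_apply, map_mul, map_mul,
    constantCoeff_rotheSeries, constantCoeff_rotheSeries]
  linarith

lemma pathPoly_succ (β δ x : ℚ) (m : ℕ) :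
    pathPoly β δ (m + 1) x = pathPoly β δ (m + 1) (x - 1) + pathPoly β δ m x := by
  have h := rotheSeries_sub β (x - β * (m + 1 : ℕ))
  rw [show x - β * (m + 1 : ℕ) - 1 = x - 1 - β * (m + 1 : ℕ) by ring,
    show x - β * (m + 1 : ℕ) + β = x - β * m by push_cast; ring] at h
  rw [← sub_eq_iff_eq_add', pathPoly, pathPoly, pathPoly, ← map_sub, ← mul_sub, h,
    mul_left_comm, PowerSeries.coeff_succ_X_mul]

lemma pathPoly_even_eq_zero (β δ x : ℚ) (q : ℕ) (hx : x = β * (2 * (q + 1) : ℕ)) :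
    pathPoly β δ (2 * (q + 1)) x = 0 := by
  have h : rotheSeries β δ * evenSeries β δ + bar (rotheSeries β δ * evenSeries β δ) = 2 := by
    rw [map_mul, bar_evenSeries]
    linear_combination evenSeries_mul β δ
  have h' := congrArg (PowerSeries.coeff (2 * (q + 1))) h
  rw [map_add, coeff_bar_even, show (2 : PowerSeries ℚ) = PowerSeries.C 2 from (map_ofNat _ 2).symm,
    PowerSeries.coeff_C, if_neg (by omega)] at h'
  rw [pathPoly, hx, sub_self, rotheSeries_zero, mul_one]
  linarith

lemma pathPoly_odd_eq_zero (β δ x : ℚ) (q : ℕ) (hx : x = β * (2 * q + 1 : ℕ) - δ) :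
    pathPoly β δ (2 * q + 1) x = 0 := by
  rw [pathPoly, hx, show β * (2 * q + 1 : ℕ) - δ - β * (2 * q + 1 : ℕ) = -δ by ring,
    mul_right_comm, rotheSeries_mul, add_neg_cancel, rotheSeries_zero, one_mul]
  exact coeff_odd_eq_zero (bar_evenSeries β δ) q

lemma pathPoly_even_eval (β δ x : ℚ) (n : ℕ) (hx : x = β * (2 * n : ℕ) + 2 * δ) :
    pathPoly β δ (2 * n) x = (rothe β (2 * n)).eval (2 * δ) + (1 / 2) *
      ∑ i ∈ range n, (2 * (rothe β (2 * i + 1)).eval δ) *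
        (2 * (rothe β (2 * (n - 1 - i) + 1)).eval δ) := by
  set η := rotheSeries β δ with hη
  set E := evenSeries β δ with hE
  have h2 : rotheSeries β (2 * δ) = η ^ 2 := by rw [sq, hη, rotheSeries_mul, two_mul]
  have hb : bar E = E := bar_evenSeries β δ
  have hmul : E * (η + bar η) = 2 := evenSeries_mul β δ
  have hsum : (η * E * η ^ 2) + bar (η * E * η ^ 2) =
      η ^ 2 + bar (η ^ 2) + (η - bar η) ^ 2 := by
    rw [map_mul, map_mul, map_pow, hb]
    linear_combination (η ^ 2 - η * bar η + bar η ^ 2) * hmul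
  have h := congrArg (PowerSeries.coeff (2 * n)) hsum
  rw [map_add, map_add, map_add, coeff_bar_even, coeff_bar_even, coeff_sub_bar_sq, ← h2] at h
  rw [pathPoly, hx, add_sub_cancel_left]
  simp only [hη, rotheSeries, PowerSeries.coeff_mk] at h ⊢
  linarith

/-! ### Lattice paths -/

/-- Paths to `(k, m)` weakly under the boundary. -/
def pathSet (a b m k : ℕ) : Set (List Bool) :=
  {P | P.count false = k ∧ P.count true = m ∧ UnderPeriodic a b P}

lemma underPeriodic_snoc_false (a b : ℕ) (P : List Bool) :
    UnderPeriodic a b (P ++ [false]) ↔ UnderPeriodic a b P := by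
  constructor
  · rintro h q r rfl
    exact h q (r ++ [false]) (by simp)
  · intro h q r hq
    rcases r.eq_nil_or_concat' with rfl | ⟨r', x, rfl⟩
    · simpa using congrArg List.getLast? hq
    · rw [← List.cons_append, ← List.append_assoc] at hq
      exact h q r' (List.append_inj_left' hq rfl)

lemma underPeriodic_snoc_true (a b : ℕ) (P : List Bool) :
    UnderPeriodic a b (P ++ [true]) ↔
      UnderPeriodic a b P ∧ stairAbscissa a b (P.count true + 1) ≤ P.count false := by
  constructor
  · intro h
    refine ⟨?_, h P [] rfl⟩
    rintro q r rfl
    exact h q (r ++ [true]) (by simp)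
  · rintro ⟨h, hP⟩ q r hq
    rcases r.eq_nil_or_concat' with rfl | ⟨r', x, rfl⟩
    · rw [← List.append_inj_left' hq rfl]
      exact hP
    · rw [← List.cons_append, ← List.append_assoc] at hq
      exact h q r' (List.append_inj_left' hq rfl)

lemma finite_pathSet (a b m k : ℕ) : (pathSet a b m k).Finite := by
  refine (List.finite_length_eq Bool (m + k)).subset ?_
  rintro P ⟨h1, h2, -⟩
  have := List.count_true_add_count_false P
  simp only [Set.mem_ofPred_eq]
  omega

lemma pathSet_zero (a b k : ℕ) : pathSet a b 0 k = {List.replicate k false} := by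
  ext P
  simp only [pathSet, Set.mem_ofPred_eq, Set.mem_singleton_iff]
  constructor
  · rintro ⟨h1, h2, -⟩
    have hlen := List.count_true_add_count_false P
    rw [List.eq_replicate_iff]
    refine ⟨by omega, fun x hx => ?_⟩
    cases x with
    | false => rfl
    | true => exact absurd hx (List.count_eq_zero.1 h2)
  · rintro rfl
    refine ⟨by simp, by simp [List.count_replicate], fun q r h => ?_⟩
    have : true ∈ List.replicate k false := by simp [h]
    simp at this

lemma pathSet_succ_of_lt (a b m k : ℕ) (h : k < stairAbscissa a b (m + 1)) :
    pathSet a b (m + 1) k = ∅ := by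
  refine Set.eq_empty_of_forall_notMem fun P hP => ?_
  induction P using List.reverseRecOn generalizing k with
  | nil => simp [pathSet] at hP
  | append_singleton P x ih =>
    obtain ⟨h1, h2, h3⟩ := hP
    cases x with
    | false =>
      rw [underPeriodic_snoc_false] at h3
      simp at h1 h2
      exact ih (P.count false) (by omega) ⟨rfl, h2, h3⟩
    | true =>
      rw [underPeriodic_snoc_true] at h3
      simp at h1 h2
      rw [h1, h2] at h3
      omega

lemma snoc_injective (x : Bool) : Function.Injective fun P : List Bool => P ++ [x] :=
  fun _ _ h => List.append_cancel_right h

lemma pathSet_succ_zero (a b m : ℕ) (h : stairAbscissa a b (m + 1) = 0) :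
    pathSet a b (m + 1) 0 = (fun P => P ++ [true]) '' pathSet a b m 0 := by
  ext P
  rcases P.eq_nil_or_concat' with rfl | ⟨P, x, rfl⟩
  · simp [pathSet]
  · cases x with
    | false => simp [pathSet]
    | true =>
      rw [(snoc_injective true).mem_set_image]
      simp only [pathSet, Set.mem_ofPred_eq, underPeriodic_snoc_true]
      simp only [List.count_append, List.count_singleton]
      constructor
      · rintro ⟨h1, h2, h3, -⟩
        exact ⟨by simpa using h1, by simpa using h2, h3⟩
      · rintro ⟨h1, h2, h3⟩
        exact ⟨by simpa using h1, by simpa using h2, h3, by rw [h2, h]; omega⟩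

lemma pathSet_succ_succ (a b m k : ℕ) (h : stairAbscissa a b (m + 1) ≤ k + 1) :
    pathSet a b (m + 1) (k + 1) = (fun P => P ++ [false]) '' pathSet a b (m + 1) k ∪
      (fun P => P ++ [true]) '' pathSet a b m (k + 1) := by
  ext P
  rcases P.eq_nil_or_concat' with rfl | ⟨P, x, rfl⟩
  · simp [pathSet]
  · cases x with
    | false =>
      rw [Set.mem_union, (snoc_injective false).mem_set_image]
      simp [pathSet, underPeriodic_snoc_false]
    | true =>
      rw [Set.mem_union, (snoc_injective true).mem_set_image]
      simp only [pathSet, Set.mem_ofPred_eq, underPeriodic_snoc_true]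
      simp only [List.count_append, List.count_singleton]
      constructor
      · rintro ⟨h1, h2, h3, -⟩
        exact Or.inr ⟨by simpa using h1, by simpa using h2, h3⟩
      · rintro (⟨Q, -, hQ⟩ | ⟨h1, h2, h3⟩)
        · simp at hQ
        · exact ⟨by simpa using h1, by simpa using h2, h3, by rw [h2, h1]; omega⟩

lemma ncard_pathSet_succ_succ (a b m k : ℕ) (h : stairAbscissa a b (m + 1) ≤ k + 1) :
    (pathSet a b (m + 1) (k + 1)).ncard =
      (pathSet a b (m + 1) k).ncard + (pathSet a b m (k + 1)).ncard := by
  rw [pathSet_succ_succ a b m k h, Set.ncard_union_eq _ ((finite_pathSet ..).image _)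
    ((finite_pathSet ..).image _), Set.ncard_image_of_injective _ (snoc_injective _),
    Set.ncard_image_of_injective _ (snoc_injective _)]
  rw [Set.disjoint_left]
  rintro _ ⟨P, -, rfl⟩ ⟨Q, -, hQ⟩
  simp at hQ

lemma stairAbscissa_le_succ (a b d : ℕ) : stairAbscissa a b d ≤ stairAbscissa a b (d + 1) := by
  rcases Nat.even_or_odd' d with ⟨q, rfl | rfl⟩
  · simp [stairAbscissa, show (2 * q + 1) / 2 = q by omega]
  · simp [stairAbscissa, show (2 * q + 1) / 2 = q by omega,
      show (2 * q + 1 + 1) / 2 = q + 1 by omega, show (2 * q + 1 + 1) % 2 = 0 by omega, add_mul]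

lemma pathPoly_stairAbscissa (a b m : ℕ) :
    pathPoly ((a + b) / 2) ((b - a) / 2) (m + 1) (stairAbscissa a b (m + 1)) = 0 := by
  rcases Nat.even_or_odd' m with ⟨q, rfl | rfl⟩
  · apply pathPoly_odd_eq_zero
    simp [stairAbscissa, show (2 * q + 1) / 2 = q by omega]
    ring
  · rw [show 2 * q + 1 + 1 = 2 * (q + 1) by ring]
    apply pathPoly_even_eq_zero
    simp [stairAbscissa]
    ring

theorem ncard_pathSet (a b m k : ℕ) (h : stairAbscissa a b m ≤ k + 1) :
    ((pathSet a b m k).ncard : ℚ) = pathPoly ((a + b) / 2) ((b - a) / 2) m (k + 1) := by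
  induction m generalizing k with
  | zero => rw [pathSet_zero, Set.ncard_singleton, pathPoly_zero, Nat.cast_one]
  | succ m ihm =>
    have hle := stairAbscissa_le_succ a b m
    have hz := pathPoly_stairAbscissa a b m
    induction k with
    | zero =>
      rcases Nat.eq_zero_or_pos (stairAbscissa a b (m + 1)) with h0 | h0
      · rw [h0, Nat.cast_zero] at hz
        rw [pathSet_succ_zero a b m h0, Set.ncard_image_of_injective _ (snoc_injective _),
          ihm 0 (by omega), pathPoly_succ]
        simp [hz]
      · rw [pathSet_succ_of_lt a b m 0 h0, Set.ncard_empty]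
        rw [show stairAbscissa a b (m + 1) = 0 + 1 by omega] at hz
        simpa using hz.symm
    | succ k ihk =>
      rcases h.eq_or_lt with heq | hlt
      · rw [pathSet_succ_of_lt a b m (k + 1) (by omega), Set.ncard_empty]
        rw [heq] at hz
        simpa using hz.symm
      · rw [ncard_pathSet_succ_succ a b m k (by omega), Nat.cast_add, ihk (by omega),
          ihm (k + 1) (by omega), pathPoly_succ _ _ ((k + 1 : ℕ) + 1)]
        simp

lemma Mq_eq_rothe (a b i : ℕ) (hab : a < b) :
    Mq a b (a + b) i = 2 * (rothe ((a + b) / 2) (2 * i + 1)).eval (((b : ℚ) - a) / 2) := by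
  rw [rothe_eval_eq_choose _ _ (2 * i + 1) ((a + b) * i + b) (by push_cast; ring) (by omega), Mq,
    show (a + b) * i + b + (2 * i + 1) - 1 = (a + b + 2) * i + b by
      rw [add_mul (a + b) 2]; omega]
  push_cast
  ring

lemma Nq_eq_rothe (a b n : ℕ) (hab : a < b) :
    Nq a b (a + b) n = (rothe ((a + b) / 2) (2 * n)).eval (2 * (((b : ℚ) - a) / 2)) := by
  rw [rothe_eval_eq_choose _ _ (2 * n) ((a + b) * n + (b - a))
    (by rw [Nat.cast_add, Nat.cast_sub hab.le]; push_cast; ring) (by omega), Nq,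
    show (a + b) * n + (b - a) + 2 * n - 1 = (a + b + 2) * n + b - a - 1 by
      rw [add_mul (a + b) 2]; omega]
  push_cast [Nat.cast_sub hab.le]
  ring

end PeriodicPaths

open PeriodicPaths in
theorem stmt10 (a b : ℕ) (hab : a < b) (c : ℕ) (hc : c = a + b) (n : ℕ) :
    (Nat.card {P : List Bool //
        P.count false = c * n + b - a - 1 ∧ P.count true = 2 * n ∧
        UnderPeriodic a b P} : ℚ) =
      Nq a b c n + (1 / 2) * ∑ i ∈ Finset.range n, Mq a b c i * Mq a b c (n - 1 - i) := by
  subst hc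
  have hk : (((a + b) * n + b - a - 1 : ℕ) : ℚ) + 1 =
      ((a : ℚ) + b) / 2 * (2 * n : ℕ) + 2 * (((b : ℚ) - a) / 2) := by
    have : (a + b) * n + b - a - 1 + 1 + a = (a + b) * n + b := by omega
    have : (((a + b) * n + b - a - 1 : ℕ) : ℚ) + 1 + a = (a + b) * n + b := by exact_mod_cast this
    push_cast
    linarith
  have hs : stairAbscissa a b (2 * n) ≤ (a + b) * n + b - a - 1 + 1 := by
    simp only [stairAbscissa, Nat.mul_mod_right, Nat.mul_div_cancel_left n two_pos]
    rw [mul_comm n]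
    simp
    omega
  have h := ncard_pathSet a b (2 * n) _ hs
  rw [pathPoly_even_eval _ _ _ n hk, ← Nq_eq_rothe a b n hab] at h
  simp only [← Mq_eq_rothe a b _ hab] at h
  exact h
end
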